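/- arXiv:1406.0733 — 3 statements merged into one kernel-verified Lean document; each statement's English description precedes it below -/
import Mathlib

section
/- Let (Ω, d_Ω) be a Hilbert geometry of dimension n, let Vol denote the n-dimensional Hausdorff measure of the metric space (Ω, d_Ω), fix o ∈ Ω, and let B_Ω(o,R) denote the metric ball of radius R centered at o. Then the upper asymptotic volume limsup_{R→∞} Vol(B_Ω(o,R))/Rⁿ is finite if and only if Ω is the interior of a bounded convex polytope. -/
open Set Filter MeasureTheory

noncomputable section

abbrev Euc (n : ℕ) := EuclideanSpace ℝ (Fin n)

/-- `Ω` is a convex domain: a non-empty bounded open convex subset of `ℝⁿ`. -/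
def IsConvexDomain {n : ℕ} (Ω : Set (Euc n)) : Prop :=
  Ω.Nonempty ∧ IsOpen Ω ∧ Bornology.IsBounded Ω ∧ Convex ℝ Ω

/-- `d` is the Hilbert distance of the convex domain `Ω` : for distinct `p q ∈ Ω`, if `a` and
`b` are the points where the line through `p` and `q` meets `∂Ω`, in the order `a, p, q, b`
(`a = p + s•(q-p)` with `s < 0`, `b = p + t•(q-p)` with `t > 1`), then
`d p q = ½ log [a,p,q,b]`, and `d p p = 0`. -/
def IsHilbertDist {n : ℕ} (Ω : Set (Euc n)) (d : Euc n → Euc n → ℝ) : Prop :=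
  (∀ p ∈ Ω, d p p = 0) ∧
  ∀ p ∈ Ω, ∀ q ∈ Ω, p ≠ q → ∀ a b : Euc n,
    a ∈ frontier Ω → b ∈ frontier Ω →
    (∃ s t : ℝ, s < 0 ∧ 1 < t ∧ a = p + s • (q - p) ∧ b = p + t • (q - p)) →
    d p q = (1/2) * Real.log ((‖q - a‖ / ‖p - a‖) * (‖p - b‖ / ‖q - b‖))

open scoped ENNReal

/-- `X`, via the bijection `φ : X → Ω`, is the convex domain `Ω` with its Hilbert distance: the line
through two distinct points `φ p`, `φ q` leaves `Ω` at the parameters `-σ < 0` and `t > 1`, and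
`dist p q` is half the logarithm of the cross ratio. -/
structure IsHilbertGeometry {n : ℕ} (Ω : Set (Euc n)) {X : Type} [MetricSpace X]
    (φ : X → Euc n) : Prop where
  domain : IsConvexDomain Ω
  bijOn : Set.BijOn φ Set.univ Ω
  dist_eq : ∀ p q : X, p ≠ q → ∃ σ t : ℝ, 0 < σ ∧ 1 < t ∧
    φ p - σ • (φ q - φ p) ∈ frontier Ω ∧ φ p + t • (φ q - φ p) ∈ frontier Ω ∧
    dist p q = 1 / 2 * (Real.log (1 + 1 / σ) + Real.log (t / (t - 1)))

/-- A ray starting in a bounded open set meets its frontier. -/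
theorem exists_pos_add_smul_mem_frontier {n : ℕ} {Ω : Set (Euc n)} (ho : IsOpen Ω)
    (hb : Bornology.IsBounded Ω) {p w : Euc n} (hp : p ∈ Ω) (hw : w ≠ 0) :
    ∃ t : ℝ, 0 < t ∧ p + t • w ∈ frontier Ω := by
  obtain ⟨M, hM⟩ := hb.subset_ball p
  have hw' : 0 < ‖w‖ := norm_pos_iff.2 hw
  have hM0 : 0 < M := Metric.pos_of_mem_ball (hM hp)
  let g : ℝ → Euc n := fun t => p + t • w
  have hg : Continuous g := by fun_prop
  have hconn : IsPreconnected (g '' Icc 0 (M / ‖w‖)) := isPreconnected_Icc.image g hg.continuousOn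
  by_contra! H
  have hfar : g (M / ‖w‖) ∉ Ω := fun h => by
    have := hM h
    simp [g, norm_smul, abs_of_pos hM0, hw'.ne'] at this
  have hcl : ∀ x ∈ g '' Icc 0 (M / ‖w‖), x ∈ closure Ω → x ∈ Ω := by
    rintro x ⟨t, ht, rfl⟩ hx
    by_contra hxΩ
    rcases ht.1.eq_or_lt with h | h
    · exact hxΩ (by simpa [g, ← h] using hp)
    · exact H t h ⟨hx, by rwa [ho.interior_eq]⟩
  have h0 : (0 : ℝ) ∈ Icc 0 (M / ‖w‖) := ⟨le_rfl, by positivity⟩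
  have h1 : M / ‖w‖ ∈ Icc 0 (M / ‖w‖) := ⟨by positivity, le_rfl⟩
  obtain ⟨x, hx, hxΩ, hxc⟩ := hconn Ω (closure Ω)ᶜ ho isClosed_closure.isOpen_compl
    (fun x hx => (em (x ∈ closure Ω)).imp (hcl x hx) id)
    ⟨p, ⟨0, h0, by simp [g]⟩, hp⟩ ⟨_, ⟨_, h1, rfl⟩, fun h => hfar (hcl _ ⟨_, h1, rfl⟩ h)⟩
  exact hxc (subset_closure hxΩ)

/-- Points of the closure are not beyond the frontier point of a ray starting inside. -/
theorem le_of_mem_closure_of_mem_frontier {n : ℕ} {Ω : Set (Euc n)} (ho : IsOpen Ω)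
    (hc : Convex ℝ Ω) {p w : Euc n} (hp : p ∈ Ω) {r t : ℝ} (ht : 0 < t)
    (hr : p + r • w ∈ closure Ω) (htf : p + t • w ∈ frontier Ω) : r ≤ t := by
  by_contra! h
  refine htf.2 (hc.openSegment_interior_closure_subset_interior (by rwa [ho.interior_eq]) hr ?_)
  have hr0 : 0 < r := ht.trans h
  refine ⟨1 - t / r, t / r, by rw [sub_pos, div_lt_one hr0]; exact h, by positivity, by ring, ?_⟩
  rw [smul_add, smul_smul, div_mul_cancel₀ _ hr0.ne', ← add_assoc, ← add_smul]
  simp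

theorem IsHilbertDist.isHilbertGeometry {n : ℕ} {Ω : Set (Euc n)} (hΩ : IsConvexDomain Ω)
    {d : Euc n → Euc n → ℝ} (hd : IsHilbertDist Ω d) {X : Type} [MetricSpace X] {φ : X → Euc n}
    (hφ : Set.BijOn φ Set.univ Ω) (hdist : ∀ p q : X, dist p q = d (φ p) (φ q)) :
    IsHilbertGeometry Ω φ := by
  refine ⟨hΩ, hφ, fun p q hpq => ?_⟩
  obtain ⟨-, ho, hb, hc⟩ := hΩ
  have hp : φ p ∈ Ω := hφ.1 trivial
  have hq : φ q ∈ Ω := hφ.1 trivial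
  have hne : φ p ≠ φ q := fun h => hpq (hφ.2.1 trivial trivial h)
  have hw : φ q - φ p ≠ 0 := sub_ne_zero.2 hne.symm
  have hw' : 0 < ‖φ q - φ p‖ := norm_pos_iff.2 hw
  obtain ⟨t, ht, htf⟩ := exists_pos_add_smul_mem_frontier ho hb hp hw
  obtain ⟨σ, hσ, hσf⟩ := exists_pos_add_smul_mem_frontier ho hb hp (neg_ne_zero.2 hw)
  have ht1 : 1 < t := by
    refine lt_of_le_of_ne (le_of_mem_closure_of_mem_frontier ho hc hp ht
      (subset_closure (by simpa using hq)) htf) fun h => htf.2 ?_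
    rw [ho.interior_eq, ← h]
    simpa using hq
  rw [smul_neg, ← sub_eq_add_neg] at hσf
  refine ⟨σ, t, hσ, ht1, hσf, htf, ?_⟩
  rw [hdist, hd.2 _ hp _ hq hne _ _ hσf htf
    ⟨-σ, t, by linarith, ht1, by rw [neg_smul, sub_eq_add_neg], rfl⟩]
  have e1 : φ q - (φ p - σ • (φ q - φ p)) = (1 + σ) • (φ q - φ p) := by module
  have e2 : φ p - (φ p - σ • (φ q - φ p)) = σ • (φ q - φ p) := by module
  have e3 : φ p - (φ p + t • (φ q - φ p)) = (-t) • (φ q - φ p) := by module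
  have e4 : φ q - (φ p + t • (φ q - φ p)) = (-(t - 1)) • (φ q - φ p) := by module
  have ht' : 0 < t - 1 := by linarith
  rw [e1, e2, e3, e4, norm_smul, norm_smul, norm_smul, norm_smul, Real.norm_eq_abs,
    Real.norm_eq_abs, Real.norm_eq_abs, Real.norm_eq_abs, abs_neg, abs_neg, abs_of_pos ht,
    abs_of_pos ht', abs_of_pos hσ, abs_of_pos (by linarith : 0 < 1 + σ),
    mul_div_mul_right _ _ hw'.ne', mul_div_mul_right _ _ hw'.ne',
    Real.log_mul (by positivity) (by positivity)]
  congr 3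
  field_simp
  ring

namespace IsHilbertGeometry

variable {n : ℕ} {Ω : Set (Euc n)} {X : Type} [MetricSpace X] {φ : X → Euc n}

theorem map_mem (h : IsHilbertGeometry Ω φ) (p : X) : φ p ∈ Ω := h.bijOn.1 trivial

theorem isOpen (h : IsHilbertGeometry Ω φ) : IsOpen Ω := h.domain.2.1

theorem isBounded (h : IsHilbertGeometry Ω φ) : Bornology.IsBounded Ω := h.domain.2.2.1

theorem convex (h : IsHilbertGeometry Ω φ) : Convex ℝ Ω := h.domain.2.2.2

/-- The logarithm of a positive affine function is `2`-Lipschitz for the Hilbert distance. -/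
theorem log_le_log_add (h : IsHilbertGeometry Ω φ) {f : Euc n →L[ℝ] ℝ} {c : ℝ}
    (hf : ∀ x ∈ Ω, f x < c) (p q : X) :
    Real.log (c - f (φ p)) ≤ Real.log (c - f (φ q)) + 2 * dist p q := by
  rcases eq_or_ne p q with rfl | hpq
  · simp
  obtain ⟨σ, t, hσ, ht, ha, hb, hdist⟩ := h.dist_eq p q hpq
  have hcl : ∀ x ∈ closure Ω, f x ≤ c := fun x hx =>
    closure_minimal (fun y hy => (hf y hy).le) (isClosed_le f.continuous continuous_const) hx
  have hb' := hcl _ hb.1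
  simp only [map_add, map_smul, map_sub, smul_eq_mul] at hb'
  have hp := sub_pos.2 (hf _ (h.map_mem p))
  have hq := sub_pos.2 (hf _ (h.map_mem q))
  have ht' : 0 < t - 1 := by linarith
  have h1 : Real.log ((c - f (φ p)) / (c - f (φ q))) ≤ Real.log (t / (t - 1)) := by
    apply Real.log_le_log (by positivity)
    rw [div_le_div_iff₀ hq ht']
    linarith
  have h2 : 0 ≤ Real.log (1 + 1 / σ) :=
    Real.log_nonneg (by linarith [one_div_pos.2 hσ])
  rw [Real.log_div hp.ne' hq.ne'] at h1
  linarith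

theorem abs_log_sub_log_le (h : IsHilbertGeometry Ω φ) {f : Euc n →L[ℝ] ℝ} {c : ℝ}
    (hf : ∀ x ∈ Ω, f x < c) (p q : X) :
    |Real.log (c - f (φ p)) - Real.log (c - f (φ q))| ≤ 2 * dist p q := by
  have h1 := h.log_le_log_add hf p q
  have h2 := h.log_le_log_add hf q p
  rw [dist_comm q p] at h2
  rw [abs_le]
  constructor <;> linarith

theorem lipschitzWith_log (h : IsHilbertGeometry Ω φ) {f : Euc n →L[ℝ] ℝ} {c : ℝ}
    (hf : ∀ x ∈ Ω, f x < c) : LipschitzWith 2 fun p => Real.log (c - f (φ p)) :=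
  LipschitzWith.of_dist_le_mul fun p q => by
    simpa [Real.dist_eq] using h.abs_log_sub_log_le hf p q

/-- Upper bound for the Hilbert distance along a chord. -/
theorem dist_le_of_mem_closure (h : IsHilbertGeometry Ω φ) {p q : X} {v : Euc n} {κ τ : ℝ}
    (hκ : 0 < κ) (hτ : 0 ≤ τ) (hτ1 : τ < 1) (hv : v ∈ closure Ω)
    (ha : φ p - κ • (v - φ p) ∈ closure Ω) (hq : φ q = φ p + τ • (v - φ p)) :
    dist p q ≤ 1 / 2 * (Real.log (1 + τ / κ) - Real.log (1 - τ)) := by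
  have hlog1 : 0 ≤ Real.log (1 + τ / κ) :=
    Real.log_nonneg (by linarith [div_nonneg hτ hκ.le])
  have hlog2 : Real.log (1 - τ) ≤ 0 := Real.log_nonpos (by linarith) (by linarith)
  rcases eq_or_ne p q with rfl | hpq
  · simp only [dist_self]
    linarith
  have hτ0 : 0 < τ := by
    refine hτ.lt_of_ne fun h0 => hpq (h.bijOn.2.1 trivial trivial ?_)
    rw [hq, ← h0]
    simp
  obtain ⟨σ, t, hσ, ht, hσf, htf, hdist⟩ := h.dist_eq p q hpq
  have ew : φ q - φ p = τ • (v - φ p) := by rw [hq]; module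
  have h1 : 1 / τ ≤ t := by
    refine le_of_mem_closure_of_mem_frontier h.isOpen h.convex (h.map_mem p) (by linarith) ?_ htf
    rw [ew, smul_smul, one_div_mul_cancel hτ0.ne']
    simpa using hv
  have h2 : κ / τ ≤ σ := by
    refine le_of_mem_closure_of_mem_frontier (w := -(φ q - φ p)) h.isOpen h.convex (h.map_mem p)
      hσ ?_ (by rwa [smul_neg, ← sub_eq_add_neg])
    rw [ew, ← smul_neg, smul_smul, div_mul_cancel₀ _ hτ0.ne', smul_neg, ← sub_eq_add_neg]
    exact ha
  have ht' : 0 < t - 1 := by linarith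
  have h3 : Real.log (1 + 1 / σ) ≤ Real.log (1 + τ / κ) := by
    apply Real.log_le_log (by positivity)
    have : 1 / σ ≤ 1 / (κ / τ) := one_div_le_one_div_of_le (by positivity) h2
    rw [one_div_div] at this
    linarith
  have h4 : Real.log (t / (t - 1)) ≤ - Real.log (1 - τ) := by
    rw [← Real.log_inv]
    apply Real.log_le_log (by positivity)
    rw [← one_div, div_le_div_iff₀ ht' (by linarith)]
    have := (div_le_iff₀ hτ0).1 h1
    linarith
  rw [hdist]
  linarith

end IsHilbertGeometry

section Slicing

variable {X : Type} [MetricSpace X] [MeasurableSpace X] [BorelSpace X]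

/-- Almost optimal covers for the Hausdorff measure of positive integral dimension. -/
theorem exists_cover_tsum_ediam_pow_lt (A : Set X) (k : ℕ) (hA : μH[((k + 1 : ℕ) : ℝ)] A ≠ ⊤)
    {ε : ℝ≥0∞} (hε : 0 < ε) :
    ∃ t : ℕ → Set X, A ⊆ ⋃ i, t i ∧ (∀ i, Metric.ediam (t i) ≤ ε) ∧
      ∑' i, Metric.ediam (t i) ^ (k + 1) ≤ μH[((k + 1 : ℕ) : ℝ)] A + ε := by
  have h1 : (⨅ (t : ℕ → Set X) (_ : A ⊆ ⋃ n, t n) (_ : ∀ n, Metric.ediam (t n) ≤ ε),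
      ∑' n, ⨆ _ : (t n).Nonempty, Metric.ediam (t n) ^ ((k + 1 : ℕ) : ℝ))
      < μH[((k + 1 : ℕ) : ℝ)] A + ε := by
    refine lt_of_le_of_lt ?_ (ENNReal.lt_add_right hA hε.ne')
    rw [Measure.hausdorffMeasure_apply]
    exact le_iSup₂_of_le ε hε le_rfl
  simp only [iInf_lt_iff] at h1
  obtain ⟨t, ht, htd, hts⟩ := h1
  refine ⟨t, ht, htd, le_trans (le_of_eq (tsum_congr fun i => ?_)) hts.le⟩
  rcases (t i).eq_empty_or_nonempty with h | h
  · simp [h]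
  · simp only [h, iSup_pos, ENNReal.rpow_natCast]

/-- **Eilenberg's inequality**, for fibers whose measure is bounded below. -/
theorem LipschitzWith.mul_le_hausdorffMeasure_succ {F : X → ℝ} {K : NNReal}
    (hF : LipschitzWith K F) (hK : K ≠ 0) (A : Set X) (k : ℕ) {M : ℝ≥0∞} {α β : ℝ}
    (hM : ∀ s ∈ Icc α β, M ≤ μH[(k : ℝ)] (A ∩ F ⁻¹' {s})) :
    M * ENNReal.ofReal (β - α) ≤ K * μH[((k + 1 : ℕ) : ℝ)] A := by
  by_cases hA : μH[((k + 1 : ℕ) : ℝ)] A = ⊤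
  · rw [hA, ENNReal.mul_top (by simpa using hK)]
    exact le_top
  let ε : ℕ → ℝ≥0∞ := fun j => ((j : ℝ≥0∞) + 1)⁻¹
  have hε : ∀ j, 0 < ε j := fun j => by simp [ε]
  have hεt : Tendsto ε atTop (nhds 0) := by
    have := (tendsto_add_atTop_iff_nat 1).2 ENNReal.tendsto_inv_nat_nhds_zero
    simpa [ε] using this
  choose t hcov hdiam hsum using fun j => exists_cover_tsum_ediam_pow_lt A k hA (hε j)
  let I : ℕ → ℕ → Set ℝ := fun j i => closure (F '' t j i)
  have hI : ∀ j i, MeasurableSet (I j i) := fun j i => isClosed_closure.measurableSet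
  have hvol : ∀ j i, volume (I j i) ≤ K * Metric.ediam (t j i) := fun j i =>
    (Real.volume_le_diam _).trans
      ((Metric.ediam_closure _).le.trans (hF.ediam_image_le _))
  let g : ℕ → ℝ → ℝ≥0∞ := fun j s =>
    ∑' i, (I j i).indicator (fun _ => Metric.ediam (t j i) ^ k) s
  have hg : ∀ j, Measurable (g j) := fun j =>
    Measurable.tsum fun i => measurable_const.indicator (hI j i)
  have hfiber : ∀ s ∈ Icc α β, M ≤ liminf (fun j => g j s) atTop := fun s hs => by
    refine (hM s hs).trans ?_
    have := Measure.hausdorffMeasure_le_liminf_tsum (β := ℕ) (ι := fun j => {i // s ∈ I j i})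
      (k : ℝ) (A ∩ F ⁻¹' {s}) (l := atTop) ε hεt (fun j i => t j i)
      (Eventually.of_forall fun j i => hdiam j i)
      (Eventually.of_forall fun j x hx => by
        obtain ⟨i, hi⟩ := mem_iUnion.1 (hcov j hx.1)
        refine mem_iUnion.2 ⟨⟨i, ?_⟩, hi⟩
        have hxs : F x = s := hx.2
        rw [← hxs]
        exact subset_closure (mem_image_of_mem F hi))
    refine this.trans (le_of_eq ?_)
    congr 1
    funext j
    simp only [ENNReal.rpow_natCast, g]
    exact (tsum_subtype {i | s ∈ I j i} (fun i => Metric.ediam (t j i) ^ k)).trans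
      (tsum_congr fun i => rfl)
  calc M * ENNReal.ofReal (β - α) = ∫⁻ _ in Icc α β, M := by simp
    _ ≤ ∫⁻ s in Icc α β, liminf (fun j => g j s) atTop :=
        setLIntegral_mono' measurableSet_Icc hfiber
    _ ≤ ∫⁻ s, liminf (fun j => g j s) atTop := setLIntegral_le_lintegral _ _
    _ ≤ liminf (fun j => ∫⁻ s, g j s) atTop := lintegral_liminf_le hg
    _ ≤ liminf (fun j => K * (μH[((k + 1 : ℕ) : ℝ)] A + ε j)) atTop := by
        refine liminf_le_liminf (Eventually.of_forall fun j => ?_)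
        calc ∫⁻ s, g j s = ∑' i, Metric.ediam (t j i) ^ k * volume (I j i) := by
              rw [lintegral_tsum fun i => (measurable_const.indicator (hI j i)).aemeasurable]
              exact tsum_congr fun i => lintegral_indicator_const (hI j i) _
          _ ≤ ∑' i, K * Metric.ediam (t j i) ^ (k + 1) :=
              ENNReal.tsum_le_tsum fun i => by
                rw [pow_succ, mul_left_comm]
                gcongr
                exact hvol j i
          _ ≤ K * (μH[((k + 1 : ℕ) : ℝ)] A + ε j) := by
              rw [ENNReal.tsum_mul_left]
              gcongr
              exact hsum j
    _ = K * μH[((k + 1 : ℕ) : ℝ)] A := by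
        refine Tendsto.liminf_eq ?_
        have := ENNReal.Tendsto.const_mul (a := (K : ℝ≥0∞))
          (hεt.const_add (μH[((k + 1 : ℕ) : ℝ)] A)) (Or.inr ENNReal.coe_ne_top)
        simpa using this

end Slicing

theorem finrank_inf_ker_add_one {V : Type*} [AddCommGroup V] [Module ℝ V] [FiniteDimensional ℝ V]
    (W : Submodule ℝ V) (f : V →ₗ[ℝ] ℝ) {w : V} (hw : w ∈ W) (hfw : f w ≠ 0) :
    Module.finrank ℝ (W ⊓ LinearMap.ker f : Submodule ℝ V) + 1 = Module.finrank ℝ W := by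
  have hne : f ∘ₗ W.subtype ≠ 0 := fun h0 => hfw (LinearMap.congr_fun h0 ⟨w, hw⟩)
  rw [← Module.Dual.finrank_ker_add_one_of_ne_zero hne, LinearMap.ker_comp,
    ← Submodule.finrank_map_subtype_eq, Submodule.map_comap_subtype]

namespace IsHilbertGeometry

variable {n : ℕ} {Ω : Set (Euc n)} {X : Type} [MetricSpace X] {φ : X → Euc n}

/-- Points approaching a boundary point `v` along a chord, in terms of a functional supporting `Ω`
at `v`. -/
theorem exists_log_eq_sub (h : IsHilbertGeometry Ω φ) {f : Euc n →L[ℝ] ℝ} {c : ℝ}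
    (hf : ∀ x ∈ Ω, f x < c) {v : Euc n} (hv : v ∈ closure Ω) (hfv : f v = c) (o : X) {κ : ℝ}
    (hκ : 0 < κ) (ha : φ o - κ • (v - φ o) ∈ closure Ω) {s : ℝ} (hs : 0 ≤ s) :
    ∃ p : X, φ p = φ o + (1 - Real.exp (-s)) • (v - φ o) ∧
      Real.log (c - f (φ p)) = Real.log (c - f (φ o)) - s ∧
      dist o p ≤ 1 / 2 * (Real.log (1 + (1 - Real.exp (-s)) / κ) + s) := by
  have hes : Real.exp (-s) ≤ 1 := Real.exp_le_one_iff.2 (by linarith)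
  have hmem : φ o + (1 - Real.exp (-s)) • (v - φ o) ∈ Ω := by
    have := h.convex.add_smul_sub_mem_interior' hv
      (by rw [h.isOpen.interior_eq]; exact h.map_mem o) ⟨Real.exp_pos (-s), hes⟩
    rw [h.isOpen.interior_eq] at this
    convert this using 1
    module
  obtain ⟨p, -, hp⟩ := h.bijOn.2.2 hmem
  refine ⟨p, hp, ?_, ?_⟩
  · have : c - f (φ p) = Real.exp (-s) * (c - f (φ o)) := by
      rw [hp]
      simp only [map_add, map_smul, map_sub, smul_eq_mul, hfv]
      ring
    rw [this, Real.log_mul (Real.exp_pos _).ne' (sub_pos.2 (hf _ (h.map_mem o))).ne',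
      Real.log_exp]
    ring
  · refine (h.dist_le_of_mem_closure hκ (by linarith) (by linarith [Real.exp_pos (-s)]) hv ha
      hp).trans (le_of_eq ?_)
    rw [show 1 - (1 - Real.exp (-s)) = Real.exp (-s) by ring, Real.log_exp]
    ring

variable [MeasurableSpace X] [BorelSpace X]

/-- Volume bound from lower bounds for balls in the level sets of a supporting functional. -/
theorem mul_le_hausdorffMeasure_ball_inter (h : IsHilbertGeometry Ω φ) {f : Euc n →L[ℝ] ℝ} {c : ℝ}
    (hf : ∀ x ∈ Ω, f x < c) (W : Submodule ℝ (Euc n)) (k : ℕ) (o : X) {R r α β : ℝ} {M : ℝ≥0∞}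
    (hM : ∀ p : X, M ≤ μH[(k : ℝ)] (Metric.ball p r ∩
      {x | φ x - φ p ∈ W ⊓ LinearMap.ker f.toLinearMap}))
    (hp : ∀ s ∈ Icc α β, ∃ p : X, dist o p ≤ R - r ∧ φ p - φ o ∈ W ∧
      Real.log (c - f (φ p)) = s) :
    M * ENNReal.ofReal (β - α) ≤ 2 * μH[((k + 1 : ℕ) : ℝ)]
      (Metric.ball o R ∩ {x | φ x - φ o ∈ W} ∩ {x | Real.log (c - f (φ x)) ≤ β}) := by
  refine (h.lipschitzWith_log hf).mul_le_hausdorffMeasure_succ two_ne_zero _ k fun s hs => ?_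
  obtain ⟨p, hdist, hpW, hps⟩ := hp s hs
  refine (hM p).trans (measure_mono ?_)
  rintro x ⟨hx, hxW, hxf⟩
  have hxp : f (φ x) = f (φ p) := sub_eq_zero.1 (by simpa using hxf)
  have hxs : Real.log (c - f (φ x)) = s := by rw [hxp, hps]
  refine ⟨⟨⟨?_, ?_⟩, ?_⟩, hxs⟩
  · rw [Metric.mem_ball] at hx ⊢
    linarith [dist_triangle x p o, dist_comm o p]
  · have := W.add_mem hxW hpW
    simpa using this
  · exact hxs.le.trans hs.2

/-- Balls of radius `R` in `k`-dimensional sections have `k`-volume at least `a * R ^ k`. -/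
theorem exists_le_hausdorffMeasure_ball_inter (h : IsHilbertGeometry Ω φ) (k : ℕ) :
    ∃ a : ℝ, 0 < a ∧ ∀ W : Submodule ℝ (Euc n), Module.finrank ℝ W = k → ∀ (o : X) (R : ℝ),
      0 < R → ENNReal.ofReal (a * R ^ k) ≤
        μH[(k : ℝ)] (Metric.ball o R ∩ {x | φ x - φ o ∈ W}) := by
  induction k with
  | zero =>
    refine ⟨1, one_pos, fun W _ o R hR => ?_⟩
    simpa using Measure.one_le_hausdorffMeasure_zero_of_nonempty
      (s := Metric.ball o R ∩ {x | φ x - φ o ∈ W}) ⟨o, by simpa using hR, by simp⟩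
  | succ k ih =>
    obtain ⟨a, ha, hlow⟩ := ih
    refine ⟨a / 2 ^ (k + 2), by positivity, fun W hW o R hR => ?_⟩
    have ho := h.map_mem o
    have hWne : W ≠ ⊥ := by
      rintro rfl
      simp at hW
    obtain ⟨w₀, hw₀, hw₀0⟩ := W.ne_bot_iff.1 hWne
    obtain ⟨t₁, ht₁, ht₁f⟩ := exists_pos_add_smul_mem_frontier h.isOpen h.isBounded ho hw₀0
    obtain ⟨t₂, ht₂, ht₂f⟩ :=
      exists_pos_add_smul_mem_frontier h.isOpen h.isBounded ho (neg_ne_zero.2 hw₀0)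
    obtain ⟨w, t, t', hw, ht, htt', htf, ht'f⟩ : ∃ (w : Euc n) (t t' : ℝ), w ∈ W ∧ 0 < t ∧
        t ≤ t' ∧ φ o + t • w ∈ frontier Ω ∧ φ o + t' • -w ∈ frontier Ω := by
      rcases le_total t₁ t₂ with hle | hle
      · exact ⟨w₀, t₁, t₂, hw₀, ht₁, hle, ht₁f, ht₂f⟩
      · exact ⟨-w₀, t₂, t₁, W.neg_mem hw₀, ht₂, hle, ht₂f, by rwa [neg_neg]⟩
    obtain ⟨f, hf⟩ := geometric_hahn_banach_open_point h.convex h.isOpen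
      (fun hmem => htf.2 (by rwa [h.isOpen.interior_eq]) : φ o + t • w ∉ Ω)
    have hfw : f w ≠ 0 := fun h0 => by
      have := hf _ ho
      simp [h0] at this
    have hrank : Module.finrank ℝ (W ⊓ LinearMap.ker f.toLinearMap : Submodule ℝ (Euc n)) = k := by
      have := finrank_inf_ker_add_one W f.toLinearMap hw hfw
      omega
    have hopp : φ o - (1 : ℝ) • (φ o + t • w - φ o) ∈ closure Ω := by
      have ht' : 0 < t' := ht.trans_le htt'
      have := h.convex.closure (subset_closure ho) ht'f.1
        (sub_nonneg.2 ((div_le_one ht').2 htt')) (div_nonneg ht.le ht'.le) (by ring)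
      convert this using 1
      rw [smul_add (t / t'), smul_smul, div_mul_cancel₀ _ ht'.ne']
      module
    have key := h.mul_le_hausdorffMeasure_ball_inter hf W k o (R := R) (r := R / 2)
      (α := Real.log (f (φ o + t • w) - f (φ o)) - R / 2)
      (β := Real.log (f (φ o + t • w) - f (φ o))) (fun p => hlow _ hrank p (R / 2) (by positivity))
      (fun s hs => by
        obtain ⟨p, hp, hps, hdist⟩ := h.exists_log_eq_sub hf htf.1 rfl o one_pos hopp
          (s := Real.log (f (φ o + t • w) - f (φ o)) - s) (by linarith [hs.2])
        refine ⟨p, ?_, ?_, by rw [hps]; ring⟩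
        · set u := Real.log (f (φ o + t • w) - f (φ o)) - s
          have hu : 0 ≤ u := sub_nonneg.2 hs.2
          have hexp : Real.log (1 + (1 - Real.exp (-u)) / 1) ≤ u := by
            rw [Real.log_le_iff_le_exp (by
              linarith [Real.exp_le_one_iff.2 (by linarith : -u ≤ 0)])]
            have h1 : Real.exp u * Real.exp (-u) = 1 := by rw [← Real.exp_add]; simp
            have h2 : 0 < Real.exp (-u) := Real.exp_pos _
            have h3 : 0 < Real.exp u := Real.exp_pos _
            nlinarith [sq_nonneg (Real.exp u - 1), sq_nonneg (Real.exp (-u) - 1)]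
          linarith [hs.1]
        · rw [hp, add_sub_cancel_left, add_sub_cancel_left]
          exact W.smul_mem _ (W.smul_mem _ hw))
    rw [sub_sub_cancel, ← ENNReal.ofReal_mul (by positivity)] at key
    have h2 : ENNReal.ofReal (a * (R / 2) ^ k * (R / 2)) =
        2 * ENNReal.ofReal (a / 2 ^ (k + 2) * R ^ (k + 1)) := by
      rw [← ENNReal.ofReal_ofNat 2, ← ENNReal.ofReal_mul (by norm_num)]
      congr 1
      rw [div_pow]
      field_simp
      ring
    rw [h2, ENNReal.mul_le_mul_iff_right (by norm_num) (by norm_num)] at key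
    exact key.trans (measure_mono inter_subset_left)

/-- Caps cut off by hyperplanes contribute volume at least `a * (R / 4) ^ (k + 1)`, with `a`
independent of the cap. -/
theorem exists_forall_le_hausdorffMeasure_ball_inter_cap (h : IsHilbertGeometry Ω φ) {k : ℕ}
    (hn : n = k + 1) : ∃ a : ℝ, 0 < a ∧ ∀ (f : Euc n →L[ℝ] ℝ) (c : ℝ), (∀ x ∈ Ω, f x < c) →
      ∀ v ∈ closure Ω, f v = c → ∀ (η : ℝ), 0 < η → ∀ o : X, ∀ᶠ R : ℝ in atTop,
        ENNReal.ofReal (a * R ^ n) ≤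
          μH[(n : ℝ)] (Metric.ball o R ∩ {x | c - f (φ x) < η}) := by
  subst hn
  obtain ⟨a, ha, hlow⟩ := h.exists_le_hausdorffMeasure_ball_inter k
  refine ⟨a / 4 ^ (k + 1), by positivity, fun f c hf v hv hfv η hη o => ?_⟩
  have ho := h.map_mem o
  have hfo := hf _ ho
  have hvo : v - φ o ≠ 0 := fun h0 => by
    rw [← hfv, sub_eq_zero.1 h0] at hfo
    exact hfo.false
  have hfw : f (v - φ o) ≠ 0 := by
    rw [map_sub, hfv]
    exact (sub_pos.2 hfo).ne'
  obtain ⟨κ, hκ, hκf⟩ :=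
    exists_pos_add_smul_mem_frontier h.isOpen h.isBounded ho (neg_ne_zero.2 hvo)
  rw [smul_neg, ← sub_eq_add_neg] at hκf
  have hrank : Module.finrank ℝ
      (⊤ ⊓ LinearMap.ker f.toLinearMap : Submodule ℝ (Euc (k + 1))) = k := by
    have := finrank_inf_ker_add_one ⊤ f.toLinearMap (Submodule.mem_top (x := v - φ o)) hfw
    rw [finrank_top, finrank_euclideanSpace_fin] at this
    omega
  set L := Real.log (c - f (φ o))
  filter_upwards [eventually_gt_atTop 0, eventually_ge_atTop (2 * Real.log (1 + 1 / κ)),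
    eventually_gt_atTop (2 * (L - Real.log η))] with R hR hRκ hRη
  have key := h.mul_le_hausdorffMeasure_ball_inter hf ⊤ k o (R := R) (r := R / 4)
    (α := L - R) (β := L - R / 2) (fun p => hlow _ hrank p (R / 4) (by positivity))
    (fun s hs => by
      have hs0 : 0 ≤ L - s := by linarith [hs.2]
      obtain ⟨p, hp, hps, hdist⟩ := h.exists_log_eq_sub hf hv hfv o hκ hκf.1 hs0
      refine ⟨p, ?_, Submodule.mem_top, by rw [hps]; ring⟩
      have hlog : Real.log (1 + (1 - Real.exp (-(L - s))) / κ) ≤ Real.log (1 + 1 / κ) := by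
        have h1 : Real.exp (-(L - s)) ≤ 1 := Real.exp_le_one_iff.2 (by linarith)
        apply Real.log_le_log
        · linarith [div_nonneg (sub_nonneg.2 h1) hκ.le]
        · gcongr
          linarith [Real.exp_pos (-(L - s))]
      linarith [hs.1])
  rw [← ENNReal.ofReal_mul (by positivity)] at key
  have h2 : ENNReal.ofReal (a * (R / 4) ^ k * (L - R / 2 - (L - R))) =
      2 * ENNReal.ofReal (a / 4 ^ (k + 1) * R ^ (k + 1)) := by
    rw [← ENNReal.ofReal_ofNat 2, ← ENNReal.ofReal_mul (by norm_num)]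
    congr 1
    rw [div_pow]
    field_simp
    ring
  rw [h2, ENNReal.mul_le_mul_iff_right (by norm_num) (by norm_num)] at key
  refine key.trans (measure_mono ?_)
  rintro x ⟨⟨hx, -⟩, hxβ⟩
  refine ⟨hx, ?_⟩
  change Real.log (c - f (φ x)) ≤ L - R / 2 at hxβ
  change c - f (φ x) < η
  exact (Real.log_lt_log_iff (sub_pos.2 (hf _ (h.map_mem x))) hη).1 (by linarith)

end IsHilbertGeometry

section FarthestPoints

variable {n : ℕ}

/-- The points of `K` that are farthest from some point of the ambient space. -/
def farthestPoints (K : Set (Euc n)) : Set (Euc n) :=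
  {p | p ∈ K ∧ ∃ z, ∀ y ∈ K, dist y z ≤ dist p z}

theorem half_sq_dist_le_inner {p y z : Euc n} (h : dist y z ≤ dist p z) :
    dist y p ^ 2 / 2 ≤ inner ℝ (p - z) p - inner ℝ (p - z) y := by
  have h1 : ‖y - z‖ ^ 2 ≤ ‖p - z‖ ^ 2 := by
    rw [dist_eq_norm, dist_eq_norm] at h
    gcongr
  have h2 := norm_sub_sq_real (p - z) (p - y)
  rw [show p - z - (p - y) = y - z by abel, inner_sub_right] at h2
  rw [dist_comm, dist_eq_norm]
  linarith

/-- In a compact set, whatever is not in a closed convex set `D` can be separated from it by a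
large ball centred far away. -/
theorem IsCompact.subset_of_farthestPoints_subset {K D : Set (Euc n)} (hK : IsCompact K)
    (hD : IsCompact D) (hDc : Convex ℝ D) (h : farthestPoints K ⊆ D) : K ⊆ D := by
  intro x hx
  by_contra hxD
  obtain ⟨f, u, hfD, hfx⟩ := geometric_hahn_banach_closed_point hDc hD.isClosed hxD
  obtain ⟨w, rfl⟩ := (InnerProductSpace.toDual ℝ (Euc n)).surjective f
  simp only [InnerProductSpace.toDual_apply_apply] at hfD hfx
  obtain ⟨M, hM⟩ := hD.isBounded.subset_closedBall x
  set ε := inner ℝ w x - u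
  have hε : 0 < ε := sub_pos.2 hfx
  set T := (M ^ 2 + 1) / (2 * ε)
  have hT : 2 * T * ε = M ^ 2 + 1 := by
    simp only [T]
    field_simp
  have hT0 : 0 < T := by positivity
  obtain ⟨p, hpK, hp⟩ := hK.exists_isMaxOn ⟨x, hx⟩
    (continuous_id.dist (continuous_const (y := x - T • w))).continuousOn
  have hpD : p ∈ D := h ⟨hpK, _, fun y hy => hp hy⟩
  have h1 : dist x (x - T • w) ≤ dist p (x - T • w) := hp hx
  rw [dist_eq_norm, dist_eq_norm, show x - (x - T • w) = T • w by abel,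
    show p - (x - T • w) = (p - x) + T • w by abel] at h1
  have h2 : ‖T • w‖ ^ 2 ≤ ‖(p - x) + T • w‖ ^ 2 := by gcongr
  rw [norm_add_sq_real, inner_smul_right, real_inner_comm, inner_sub_right] at h2
  have h3 : ‖p - x‖ ^ 2 ≤ M ^ 2 := by
    have := hM hpD
    rw [Metric.mem_closedBall, dist_eq_norm] at this
    gcongr
  have h4 : T * (inner ℝ w p - inner ℝ w x) ≤ T * (-ε) := by
    gcongr
    linarith [hfD p hpD]
  linarith

theorem IsConvexDomain.interior_closure {Ω : Set (Euc n)} (hΩ : IsConvexDomain Ω) :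
    interior (closure Ω) = Ω := by
  obtain ⟨hne, ho, -, hc⟩ := hΩ
  rw [hc.interior_closure_eq_interior_of_nonempty_interior (by rwa [ho.interior_eq]),
    ho.interior_eq]

/-- A convex domain whose closure has finitely many farthest points is a polytope. -/
theorem IsConvexDomain.exists_eq_interior_convexHull {Ω : Set (Euc n)} (hΩ : IsConvexDomain Ω)
    (hfin : (farthestPoints (closure Ω)).Finite) :
    ∃ F : Finset (Euc n), Ω = interior (convexHull ℝ (↑F : Set (Euc n))) := by
  refine ⟨hfin.toFinset, ?_⟩
  rw [hfin.coe_toFinset]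
  refine hΩ.interior_closure.symm.trans (congrArg interior (subset_antisymm (hΩ.2.2.1.isCompact_closure.subset_of_farthestPoints_subset
    (hfin.isCompact_convexHull ℝ) (convex_convexHull ℝ _) (subset_convexHull ℝ _)) ?_))
  exact convexHull_min (fun p hp => hp.1) hΩ.2.2.2.closure

end FarthestPoints

namespace IsHilbertGeometry

variable {n : ℕ} {Ω : Set (Euc n)} {X : Type} [MetricSpace X] {φ : X → Euc n}

/-- A farthest point can be cut off from the rest of the domain by a hyperplane. -/
theorem exists_cap_subset (h : IsHilbertGeometry Ω φ) {p q : Euc n}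
    (hp : p ∈ farthestPoints (closure Ω)) (hq : q ∈ closure Ω) (hqp : q ≠ p) {U : Set (Euc n)}
    (hU : U ∈ nhds p) : ∃ (f : Euc n →L[ℝ] ℝ) (c : ℝ), (∀ x ∈ Ω, f x < c) ∧ f p = c ∧
      ∃ η : ℝ, 0 < η ∧ ∀ x ∈ Ω, c - f x < η → x ∈ U := by
  obtain ⟨hpK, z, hz⟩ := hp
  have hpz : p - z ≠ 0 := fun h0 => by
    have := hz q hq
    rw [sub_eq_zero.1 h0, dist_self] at this
    exact hqp ((dist_le_zero.1 this).trans (sub_eq_zero.1 h0).symm)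
  have hle : ∀ x ∈ Ω, inner ℝ (p - z) x ≤ inner ℝ (p - z) p := fun x hx => by
    have := half_sq_dist_le_inner (hz x (subset_closure hx))
    linarith [div_nonneg (sq_nonneg (dist x p)) zero_le_two]
  obtain ⟨ρ, hρ, hρU⟩ := Metric.mem_nhds_iff.1 hU
  refine ⟨innerSL ℝ (p - z), inner ℝ (p - z) p, fun x hx => ?_, rfl, ρ ^ 2 / 2, by positivity,
    fun x hx hxη => hρU ?_⟩
  · have hne : innerSL ℝ (p - z) ≠ 0 := fun h0 =>
      hpz (inner_self_eq_zero.1 (DFunLike.congr_fun h0 (p - z)))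
    have himg := (innerSL ℝ (p - z)).isOpenMap_of_ne_zero hne Ω h.isOpen
    have hsub : innerSL ℝ (p - z) '' Ω ⊆ Iic (inner ℝ (p - z) p) := by
      rintro _ ⟨y, hy, rfl⟩
      exact hle y hy
    have := interior_maximal hsub himg (mem_image_of_mem _ hx)
    rwa [interior_Iic] at this
  · have h1 := half_sq_dist_le_inner (hz x (subset_closure hx))
    rw [innerSL_apply_apply] at hxη
    rw [Metric.mem_ball]
    refine lt_of_pow_lt_pow_left₀ 2 hρ.le ?_
    linarith

variable [MeasurableSpace X] [BorelSpace X]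

theorem limsup_eq_top_of_infinite (h : IsHilbertGeometry Ω φ)
    (hinf : (farthestPoints (closure Ω)).Infinite) (o : X) :
    Filter.limsup (fun R : ℝ => μH[(n : ℝ)] (Metric.ball o R) / ENNReal.ofReal (R ^ n))
      Filter.atTop = ⊤ := by
  obtain ⟨k, hn⟩ : ∃ k, n = k + 1 := by
    refine Nat.exists_eq_succ_of_ne_zero ?_
    rintro rfl
    exact hinf (Set.toFinite _)
  obtain ⟨a, ha, hcap⟩ := h.exists_forall_le_hausdorffMeasure_ball_inter_cap hn
  refine ENNReal.eq_top_of_forall_nnreal_le fun B => ?_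
  obtain ⟨N, hN⟩ := exists_nat_gt (max 1 (B / a))
  obtain ⟨T, hTsub, hTcard⟩ := hinf.exists_subset_card_eq N
  obtain ⟨U, hU, hdisj⟩ := T.finite_toSet.t2_separation
  have hcaps : ∀ p ∈ T, ∃ (f : Euc n →L[ℝ] ℝ) (c : ℝ), (∀ x ∈ Ω, f x < c) ∧ f p = c ∧
      ∃ η : ℝ, 0 < η ∧ ∀ x ∈ Ω, c - f x < η → x ∈ U p := fun p hp => by
    have h1T : 1 < T.card := by
      rw [hTcard]
      exact_mod_cast (le_max_left _ _).trans_lt hN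
    obtain ⟨q, hqT, hqp⟩ := Finset.exists_mem_ne h1T p
    exact h.exists_cap_subset (hTsub hp) (hTsub hqT).1 hqp ((hU p).2.mem_nhds (hU p).1)
  choose! f c hf hfp η hη hfU using hcaps
  let S : Euc n → Set X := fun p => {x | c p - f p (φ x) < η p}
  have hSmeas : ∀ p ∈ T, MeasurableSet (S p) := fun p hp => by
    have : S p = {x | Real.log (c p - f p (φ x)) < Real.log (η p)} := by
      ext x
      exact (Real.log_lt_log_iff (sub_pos.2 (hf p hp _ (h.map_mem x))) (hη p hp)).symm
    rw [this]
    exact (isOpen_lt (h.lipschitzWith_log (hf p hp)).continuous continuous_const).measurableSet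
  have hSdisj : (T : Set (Euc n)).PairwiseDisjoint S := fun p hp q hq hpq =>
    Set.disjoint_left.2 fun x hxp hxq => Set.disjoint_left.1 (hdisj hp hq hpq)
      (hfU p hp _ (h.map_mem x) hxp) (hfU q hq _ (h.map_mem x) hxq)
  have hev : ∀ᶠ R : ℝ in atTop, ∀ p ∈ T,
      ENNReal.ofReal (a * R ^ n) ≤ μH[(n : ℝ)] (Metric.ball o R ∩ S p) :=
    (Finset.eventually_all T).2 fun p hp =>
      hcap (f p) (c p) (hf p hp) p (hTsub hp).1 (hfp p hp) (η p) (hη p hp) o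
  refine le_limsup_of_frequently_le' (Eventually.frequently ?_)
  filter_upwards [hev, eventually_gt_atTop 0] with R hR hR0
  rw [ENNReal.le_div_iff_mul_le (Or.inl (by simpa using by positivity))
    (Or.inl ENNReal.ofReal_ne_top)]
  calc (B : ℝ≥0∞) * ENNReal.ofReal (R ^ n) = ENNReal.ofReal (B * R ^ n) := by
        rw [ENNReal.ofReal_mul B.coe_nonneg, ENNReal.ofReal_coe_nnreal]
    _ ≤ ENNReal.ofReal (N * (a * R ^ n)) := by
        refine ENNReal.ofReal_le_ofReal ?_
        rw [← mul_assoc]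
        gcongr
        exact ((div_lt_iff₀ ha).1 ((le_max_right _ _).trans_lt hN)).le
    _ = ∑ _p ∈ T, ENNReal.ofReal (a * R ^ n) := by
        rw [Finset.sum_const, hTcard, nsmul_eq_mul, ENNReal.ofReal_mul (Nat.cast_nonneg _),
          ENNReal.ofReal_natCast]
    _ ≤ ∑ p ∈ T, μH[(n : ℝ)] (Metric.ball o R ∩ S p) := Finset.sum_le_sum hR
    _ = μH[(n : ℝ)] (⋃ p ∈ T, Metric.ball o R ∩ S p) :=
        (measure_biUnion_finset (fun p hp q hq hpq => (hSdisj hp hq hpq).mono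
          inter_subset_right inter_subset_right)
          fun p hp => Metric.isOpen_ball.measurableSet.inter (hSmeas p hp)).symm
    _ ≤ μH[(n : ℝ)] (Metric.ball o R) :=
        measure_mono (iUnion₂_subset fun p _ => inter_subset_left)

end IsHilbertGeometry

section Polytope

variable {n : ℕ}

/-- A polytope has only finitely many facets, described through its polar at an interior point. -/
theorem exists_finset_interior_convexHull_eq (F : Finset (Euc n)) {o : Euc n}
    (ho : o ∈ interior (convexHull ℝ (F : Set (Euc n)))) :
    ∃ G : Finset (Euc n), interior (convexHull ℝ (F : Set (Euc n))) =
      {x | ∀ u ∈ G, inner ℝ u x < 1 + inner ℝ u o} := by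
  set K := convexHull ℝ (F : Set (Euc n))
  have hKc : Convex ℝ K := convex_convexHull ℝ _
  have hKclosed : IsClosed K := F.finite_toSet.isClosed_convexHull ℝ
  let P : Set (Euc n) := {u | ∀ v ∈ F, inner ℝ u (v - o) ≤ 1}
  have hPK : ∀ u ∈ P, ∀ x ∈ K, inner ℝ u (x - o) ≤ 1 := fun u hu x hx => by
    have hsub : K ⊆ {x | inner ℝ u x ≤ 1 + inner ℝ u o} := by
      refine convexHull_min (fun v hv => ?_) (convex_halfSpace_le (innerSL ℝ u).isLinear _)
      have := hu v hv
      rw [inner_sub_right] at this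
      exact sub_le_iff_le_add.1 this
    have : inner ℝ u x ≤ 1 + inner ℝ u o := hsub hx
    rw [inner_sub_right]
    linarith
  have hPclosed : IsClosed P := by
    have : P = ⋂ v ∈ F, {u | inner ℝ u (v - o) ≤ 1} := by ext u; simp [P]
    rw [this]
    exact isClosed_biInter fun v _ =>
      isClosed_le (continuous_id.inner continuous_const) continuous_const
  have hPconv : Convex ℝ P := by
    intro u hu u' hu' a b ha hb hab v hv
    rw [inner_add_left, real_inner_smul_left, real_inner_smul_left]
    nlinarith [mul_le_mul_of_nonneg_left (hu v hv) ha, mul_le_mul_of_nonneg_left (hu' v hv) hb]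
  obtain ⟨ρ, hρ, hρK⟩ := Metric.mem_nhds_iff.1 (mem_interior_iff_mem_nhds.1 ho)
  have hPbdd : Bornology.IsBounded P := by
    refine (Metric.isBounded_closedBall (x := (0 : Euc n)) (r := 2 / ρ)).subset fun u hu => ?_
    rw [mem_closedBall_zero_iff]
    rcases eq_or_ne u 0 with rfl | hu0
    · simpa using by positivity
    have hu0' : 0 < ‖u‖ := norm_pos_iff.2 hu0
    have hx : o + (ρ / 2 / ‖u‖) • u ∈ K := hρK (by
      rw [Metric.mem_ball, dist_eq_norm, add_sub_cancel_left, norm_smul, Real.norm_eq_abs,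
        abs_of_pos (by positivity), div_mul_cancel₀ _ hu0'.ne']
      linarith)
    have h1 := hPK u hu _ hx
    rw [add_sub_cancel_left, real_inner_smul_right, real_inner_self_eq_norm_sq] at h1
    rw [le_div_iff₀ hρ]
    have h2 : ρ / 2 / ‖u‖ * ‖u‖ ^ 2 = ρ / 2 * ‖u‖ := by field_simp
    linarith
  have hPcomp : IsCompact P := Metric.isCompact_of_isClosed_isBounded hPclosed hPbdd
  have hfin : (P.extremePoints ℝ).Finite := by
    classical
    refine Set.Finite.of_finite_image (f := fun u => F.filter fun v => inner ℝ u (v - o) = 1)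
      (F.powerset.finite_toSet.subset ?_) ?_
    · rintro _ ⟨u, -, rfl⟩
      exact Finset.mem_coe.2 (Finset.mem_powerset.2 (Finset.filter_subset _ _))
    · intro u hu u' hu' heq
      obtain ⟨huP, hext⟩ := mem_extremePoints_iff_left.1 hu
      have hev : ∀ᶠ ε : ℝ in nhdsWithin 0 (Ioi 0), ∀ v ∈ F,
          inner ℝ (u - ε • (u' - u)) (v - o) ≤ 1 := by
        refine (Finset.eventually_all F).2 fun v hv => ?_
        rcases (huP v hv).eq_or_lt with h1 | h1
        · have h2 : v ∈ F.filter fun v => inner ℝ u' (v - o) = 1 := by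
            have h3 : v ∈ F.filter fun v => inner ℝ u (v - o) = 1 := by simp [hv, h1]
            rwa [show (F.filter fun v => inner ℝ u (v - o) = 1) =
              F.filter fun v => inner ℝ u' (v - o) = 1 from heq] at h3
          refine Eventually.of_forall fun ε => ?_
          rw [inner_sub_left, real_inner_smul_left, inner_sub_left u' u, h1,
            (Finset.mem_filter.1 h2).2]
          simp
        · have hcont : Continuous fun ε : ℝ => inner ℝ (u - ε • (u' - u)) (v - o) := by fun_prop
          have := hcont.tendsto 0
          simp only [zero_smul, sub_zero] at this
          exact nhdsWithin_le_nhds ((this.eventually_lt_const h1).mono fun _ => le_of_lt)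
      obtain ⟨ε, hεP, hε⟩ := (hev.and self_mem_nhdsWithin).exists
      have hε0 : 0 < ε := hε
      have h3 := hext _ hεP u' hu'.1 ⟨1 / (1 + ε), ε / (1 + ε), by positivity, by positivity,
        by field_simp, by
          have e1 : 1 / (1 + ε) * ε = ε / (1 + ε) := by ring
          have e2 : (1 : ℝ) = 1 / (1 + ε) + ε / (1 + ε) := by field_simp
          rw [smul_sub, smul_smul, e1]
          calc _ = (1 / (1 + ε) + ε / (1 + ε)) • u := by module
            _ = u := by rw [← e2, one_smul]⟩
      rw [sub_eq_self, smul_eq_zero, sub_eq_zero] at h3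
      exact (h3.resolve_left hε0.ne').symm
  refine ⟨hfin.toFinset, subset_antisymm (fun x hx u hu => ?_) fun x hx => ?_⟩
  · have huP : u ∈ P := (hfin.mem_toFinset.1 hu).1
    rcases eq_or_ne u 0 with rfl | hu0
    · simp
    have hne : innerSL ℝ u ≠ 0 := fun h0 =>
      hu0 (inner_self_eq_zero.1 (DFunLike.congr_fun h0 u))
    have himg := (innerSL ℝ u).isOpenMap_of_ne_zero hne _ (isOpen_interior (s := K))
    have hsub : innerSL ℝ u '' interior K ⊆ Iic (1 + inner ℝ u o) := by
      rintro _ ⟨y, hy, rfl⟩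
      have := hPK u huP y (interior_subset hy)
      rw [inner_sub_right] at this
      exact sub_le_iff_le_add.1 this
    have := interior_maximal hsub himg (mem_image_of_mem _ hx)
    rwa [interior_Iic] at this
  · by_contra hxK
    obtain ⟨f, hf⟩ := geometric_hahn_banach_open_point hKc.interior isOpen_interior hxK
    obtain ⟨w, rfl⟩ := (InnerProductSpace.toDual ℝ (Euc n)).surjective f
    simp only [InnerProductSpace.toDual_apply_apply] at hf
    have hpos : 0 < inner ℝ w (x - o) := by
      rw [inner_sub_right, sub_pos]
      exact hf o ho
    have hclK : K ⊆ {y | inner ℝ w y ≤ inner ℝ w x} := by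
      rw [← hKclosed.closure_eq,
        ← hKc.closure_interior_eq_closure_of_nonempty_interior ⟨o, ho⟩]
      exact closure_minimal (fun y hy => (hf y hy).le)
        (isClosed_le (continuous_const.inner continuous_id) continuous_const)
    have hwP : (inner ℝ w (x - o))⁻¹ • w ∈ P := fun v hv => by
      have h1 : inner ℝ w v ≤ inner ℝ w x := hclK (subset_convexHull ℝ _ hv)
      rw [real_inner_smul_left, inv_mul_le_iff₀ hpos, mul_one, inner_sub_right, inner_sub_right]
      linarith
    have hsub : P ⊆ {u | inner ℝ u (x - o) < 1} := by
      rw [← closure_convexHull_extremePoints hPcomp hPconv,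
        (hfin.isClosed_convexHull ℝ).closure_eq]
      refine convexHull_min (fun u hu => ?_) fun u hu u' hu' a b ha hb hab => ?_
      · have := hx u (hfin.mem_toFinset.2 hu)
        change inner ℝ u (x - o) < 1
        rw [inner_sub_right]
        linarith
      · have h1 : inner ℝ u (x - o) < 1 := hu
        have h2 : inner ℝ u' (x - o) < 1 := hu'
        change inner ℝ (a • u + b • u') (x - o) < 1
        rw [inner_add_left, real_inner_smul_left, real_inner_smul_left]
        exact convex_Iio (𝕜 := ℝ) (1 : ℝ) h1 h2 ha hb hab
    have h1 : inner ℝ ((inner ℝ w (x - o))⁻¹ • w) (x - o) < 1 := hsub hwP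
    rw [real_inner_smul_left, inv_mul_cancel₀ hpos.ne'] at h1
    exact h1.false

/-- Greedy choice of a basis: every vector is a combination of basis vectors of smaller weight. -/
theorem exists_greedy_linearIndepOn {V : Type*} [AddCommGroup V] [Module ℝ V] (G : Finset V)
    (w : V → ℝ) : ∃ I ⊆ G, LinearIndepOn ℝ id (I : Set V) ∧
      ∀ f ∈ G, f ∈ Submodule.span ℝ {g | g ∈ I ∧ w g ≤ w f} := by
  classical
  induction G using Finset.induction_on_max_value w with
  | empty => exact ⟨∅, subset_rfl, by simp, by simp⟩
  | insert a s has hmax ih =>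
    obtain ⟨I, hI, hind, hspan⟩ := ih
    by_cases ha : a ∈ Submodule.span ℝ (I : Set V)
    · refine ⟨I, hI.trans (Finset.subset_insert _ _), hind, fun f hf => ?_⟩
      rcases Finset.mem_insert.1 hf with rfl | hf
      · exact Submodule.span_mono (fun g hg => And.intro hg (hmax g (hI hg))) ha
      · exact hspan f hf
    · refine ⟨insert a I, Finset.insert_subset_insert a hI, ?_, fun f hf => ?_⟩
      · rw [Finset.coe_insert]
        exact hind.id_insert ha
      · rcases Finset.mem_insert.1 hf with rfl | hf
        · exact Submodule.subset_span ⟨Finset.mem_insert_self _ _, le_rfl⟩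
        · exact Submodule.span_mono
            (fun g hg => And.intro (Finset.mem_insert_of_mem hg.1) hg.2)
            (hspan f hf)

/-- Uniform bound on coefficients of linear combinations of subsets of a finite set. -/
theorem exists_uniform_coefficients {V : Type*} [AddCommGroup V] [Module ℝ V] (G : Finset V) :
    ∃ C : ℝ, 1 ≤ C ∧ ∀ S ⊆ G, ∀ f ∈ G, f ∈ Submodule.span ℝ (S : Set V) →
      ∃ a : V → ℝ, ∑ g ∈ S, a g • g = f ∧ ∑ g ∈ S, |a g| ≤ C := by
  have hex : ∀ (S : Finset V) (f : V), ∃ a : V → ℝ, f ∈ Submodule.span ℝ (S : Set V) →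
      ∑ g ∈ S, a g • g = f := fun S f => by
    by_cases hf : f ∈ Submodule.span ℝ (S : Set V)
    · obtain ⟨a, -, ha⟩ := Submodule.mem_span_finset.1 hf
      exact ⟨a, fun _ => ha⟩
    · exact ⟨0, fun h => absurd h hf⟩
  choose a ha using hex
  have hnn : ∀ S f, 0 ≤ ∑ g ∈ S, |a S f g| := fun S f => Finset.sum_nonneg fun g _ => abs_nonneg _
  refine ⟨1 + ∑ S ∈ G.powerset, ∑ f ∈ G, ∑ g ∈ S, |a S f g|,
    le_add_of_nonneg_right (Finset.sum_nonneg fun S _ => Finset.sum_nonneg fun f _ => hnn S f),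
    fun S hS f hf hfS => ⟨a S f, ha S f hfS, ?_⟩⟩
  have h1 := Finset.single_le_sum (f := fun f => ∑ g ∈ S, |a S f g|) (fun f _ => hnn S f) hf
  have h2 := Finset.single_le_sum (f := fun S => ∑ f ∈ G, ∑ g ∈ S, |a S f g|)
    (fun S _ => Finset.sum_nonneg fun f _ => hnn S f) (Finset.mem_powerset.2 hS)
  beta_reduce at h1 h2
  linarith

end Polytope

theorem hausdorffMeasure_le_of_dist_le {X Y : Type*} [MetricSpace X] [MeasurableSpace X]
    [BorelSpace X] [MetricSpace Y] [MeasurableSpace Y] [BorelSpace Y] {f : X → Y} {A : Set X}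
    {K : NNReal} (hf : ∀ p ∈ A, ∀ q ∈ A, dist p q ≤ K * dist (f p) (f q)) {d : ℝ} (hd : 0 ≤ d) :
    μH[d] A ≤ (K : ℝ≥0∞) ^ d * μH[d] (f '' A) := by
  have hanti : AntilipschitzWith K (A.domRestrict f) :=
    AntilipschitzWith.of_le_mul_dist fun p q => hf p p.2 q q.2
  have h1 := hanti.le_hausdorffMeasure_image hd univ
  rw [image_univ, range_domRestrict] at h1
  have h2 := (isometry_subtype_coe (s := A)).hausdorffMeasure_image (Or.inl hd) univ
  rw [image_univ, Subtype.range_coe] at h2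
  rwa [h2]

/-- Control of a positive quantity by positive quantities that do not exceed it. -/
theorem log_sub_log_le_of_sub_eq_sum {V : Type*} {S : Finset V} {x y a : V → ℝ} {r s C δ : ℝ}
    (hC : 1 ≤ C) (ha : ∑ g ∈ S, |a g| ≤ C) (hr : 0 < r) (hs : 0 < s)
    (hrs : s - r = ∑ g ∈ S, a g * (y g - x g)) (hx : ∀ g ∈ S, 0 < x g) (hy : ∀ g ∈ S, 0 < y g)
    (hxr : ∀ g ∈ S, x g ≤ r) (hδ : 0 ≤ δ)
    (hxy : ∀ g ∈ S, |Real.log (x g) - Real.log (y g)| ≤ δ) :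
    Real.log s - Real.log r ≤ C * δ := by
  have hE : 0 ≤ Real.exp δ - 1 := by linarith [Real.add_one_le_exp δ]
  have hterm : ∀ g ∈ S, |y g - x g| ≤ (Real.exp δ - 1) * r := fun g hg => by
    have h1 := abs_le.1 (hxy g hg)
    have h2 : y g ≤ Real.exp δ * x g := by
      rw [← Real.log_le_log_iff (hy g hg) (mul_pos (Real.exp_pos _) (hx g hg)),
        Real.log_mul (Real.exp_pos _).ne' (hx g hg).ne', Real.log_exp]
      linarith
    have h3 : x g ≤ Real.exp δ * y g := by
      rw [← Real.log_le_log_iff (hx g hg) (mul_pos (Real.exp_pos _) (hy g hg)),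
        Real.log_mul (Real.exp_pos _).ne' (hy g hg).ne', Real.log_exp]
      linarith
    have h4 : |y g - x g| ≤ (Real.exp δ - 1) * x g := by
      rw [abs_le]
      constructor
      · nlinarith [Real.exp_pos δ, mul_nonneg hE (hx g hg).le, mul_nonneg hE hE, hx g hg]
      · linarith
    exact h4.trans (mul_le_mul_of_nonneg_left (hxr g hg) hE)
  have hsum : s - r ≤ C * ((Real.exp δ - 1) * r) := by
    rw [hrs]
    calc ∑ g ∈ S, a g * (y g - x g) ≤ ∑ g ∈ S, |a g| * ((Real.exp δ - 1) * r) :=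
          Finset.sum_le_sum fun g hg => (le_abs_self _).trans (by
            rw [abs_mul]
            exact mul_le_mul_of_nonneg_left (hterm g hg) (abs_nonneg _))
      _ = (∑ g ∈ S, |a g|) * ((Real.exp δ - 1) * r) := (Finset.sum_mul ..).symm
      _ ≤ C * ((Real.exp δ - 1) * r) := mul_le_mul_of_nonneg_right ha (by positivity)
  have hbern := one_add_mul_self_le_rpow_one_add (by linarith : -1 ≤ Real.exp δ - 1) hC
  rw [add_sub_cancel, ← Real.exp_mul] at hbern
  have h5 : s ≤ Real.exp (δ * C) * r := by nlinarith
  rw [← Real.log_le_log_iff hs (by positivity), Real.log_mul (Real.exp_pos _).ne' hr.ne',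
    Real.log_exp] at h5
  linarith

namespace IsHilbertGeometry

section

variable {n : ℕ} {Ω : Set (Euc n)} {X : Type} [MetricSpace X] {φ : X → Euc n}
  {G : Finset (Euc n)} {c : Euc n → ℝ}

theorem dist_le_of_abs_log_le (h : IsHilbertGeometry Ω φ)
    (hG : Ω = {x | ∀ u ∈ G, inner ℝ u x < c u}) {p q : X} {B : ℝ} (hB : 0 ≤ B)
    (hpq : ∀ u ∈ G, |Real.log (c u - inner ℝ u (φ p)) - Real.log (c u - inner ℝ u (φ q))| ≤ B) :
    dist p q ≤ B := by
  rcases eq_or_ne p q with rfl | hne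
  · simpa using hB
  obtain ⟨σ, t, hσ, ht, ha, hb, hdist⟩ := h.dist_eq p q hne
  have hfr : ∀ x ∈ frontier Ω, ∃ u ∈ G, c u ≤ inner ℝ u x := fun x hx => by
    have := hx.2
    rw [h.isOpen.interior_eq, hG] at this
    simpa using this
  have hpos : ∀ p : X, ∀ u ∈ G, 0 < c u - inner ℝ u (φ p) := fun p u hu => by
    have := h.map_mem p
    rw [hG] at this
    exact sub_pos.2 (this u hu)
  have ht' : 0 < t - 1 := by linarith
  obtain ⟨u, hu, hau⟩ := hfr _ ha
  obtain ⟨v, hv, hbv⟩ := hfr _ hb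
  rw [inner_sub_right, real_inner_smul_right, inner_sub_right] at hau
  rw [inner_add_right, real_inner_smul_right, inner_sub_right] at hbv
  have h1 : Real.log (1 + 1 / σ) ≤
      Real.log (c u - inner ℝ u (φ q)) - Real.log (c u - inner ℝ u (φ p)) := by
    rw [← Real.log_div (hpos q u hu).ne' (hpos p u hu).ne']
    apply Real.log_le_log (by positivity)
    rw [show 1 + 1 / σ = (σ + 1) / σ by field_simp, div_le_div_iff₀ hσ (hpos p u hu)]
    linarith
  have h2 : Real.log (t / (t - 1)) ≤
      Real.log (c v - inner ℝ v (φ p)) - Real.log (c v - inner ℝ v (φ q)) := by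
    rw [← Real.log_div (hpos p v hv).ne' (hpos q v hv).ne']
    apply Real.log_le_log (by positivity)
    rw [div_le_div_iff₀ ht' (hpos q v hv)]
    linarith
  have h3 := (abs_le.1 (hpq u hu)).1
  have h4 := (abs_le.1 (hpq v hv)).2
  rw [hdist]
  linarith

theorem span_eq_top (h : IsHilbertGeometry Ω φ)
    (hG : Ω = {x | ∀ u ∈ G, inner ℝ u x < c u}) (o : X) :
    Submodule.span ℝ (G : Set (Euc n)) = ⊤ := by
  rw [← Submodule.orthogonal_eq_bot_iff, Submodule.eq_bot_iff]
  intro w hw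
  by_contra hw0
  obtain ⟨t, -, ht⟩ := exists_pos_add_smul_mem_frontier h.isOpen h.isBounded (h.map_mem o) hw0
  refine ht.2 ?_
  have ho := h.map_mem o
  rw [h.isOpen.interior_eq]
  rw [hG] at ho ⊢
  intro u hu
  rw [inner_add_right, real_inner_smul_right,
    Submodule.inner_right_of_mem_orthogonal (Submodule.subset_span hu) hw, mul_zero, add_zero]
  exact ho u hu

end

variable {n : ℕ} {Ω : Set (Euc n)} {X : Type} [MetricSpace X] [MeasurableSpace X] [BorelSpace X]
  {φ : X → Euc n} {G : Finset (Euc n)} {c : Euc n → ℝ}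

/-- On the region where the facet functionals are combinations of smaller functionals out of `n`
given ones, the volume of balls has polynomial growth. -/
theorem hausdorffMeasure_inter_ball_le (h : IsHilbertGeometry Ω φ)
    (hG : Ω = {x | ∀ u ∈ G, inner ℝ u x < c u}) {C : ℝ} (hC : 1 ≤ C)
    (hcoef : ∀ S ⊆ G, ∀ f ∈ G, f ∈ Submodule.span ℝ (S : Set (Euc n)) →
      ∃ a : Euc n → ℝ, ∑ g ∈ S, a g • g = f ∧ ∑ g ∈ S, |a g| ≤ C)
    {I : Finset (Euc n)} (hI : I ⊆ G) (hcard : I.card = n) (o : X) {R : ℝ} (hR : 0 < R) :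
    μH[(n : ℝ)] ({p | ∀ f ∈ G, f ∈ Submodule.span ℝ
      {g | g ∈ I ∧ c g - inner ℝ g (φ p) ≤ c f - inner ℝ f (φ p)}} ∩ Metric.ball o R) ≤
        ENNReal.ofReal ((C * 4) ^ n * R ^ n) := by
  classical
  set A := {p | ∀ f ∈ G, f ∈ Submodule.span ℝ
      {g | g ∈ I ∧ c g - inner ℝ g (φ p) ≤ c f - inner ℝ f (φ p)}}
  have hpos : ∀ p : X, ∀ u ∈ G, 0 < c u - inner ℝ u (φ p) := fun p u hu => by
    have := h.map_mem p
    rw [hG] at this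
    exact sub_pos.2 (this u hu)
  let Y : X → I → ℝ := fun p g => Real.log (c g - inner ℝ (g : Euc n) (φ p))
  have hYle : ∀ p q, ∀ g ∈ I, |Real.log (c g - inner ℝ g (φ p)) -
      Real.log (c g - inner ℝ g (φ q))| ≤ dist (Y p) (Y q) := fun p q g hg =>
    dist_le_pi_dist (Y p) (Y q) ⟨g, hg⟩
  have hone : ∀ p ∈ A, ∀ q, ∀ f ∈ G, Real.log (c f - inner ℝ f (φ q)) -
      Real.log (c f - inner ℝ f (φ p)) ≤ C * dist (Y p) (Y q) := fun p hp q f hf => by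
    let S := I.filter fun g => c g - inner ℝ g (φ p) ≤ c f - inner ℝ f (φ p)
    have hSI : S ⊆ I := Finset.filter_subset _ _
    have hfS : f ∈ Submodule.span ℝ (S : Set (Euc n)) := by
      rw [Finset.coe_filter]
      exact hp f hf
    obtain ⟨a, haf, haC⟩ := hcoef S (hSI.trans hI) f hf hfS
    refine log_sub_log_le_of_sub_eq_sum (x := fun g => c g - inner ℝ g (φ p))
      (y := fun g => c g - inner ℝ g (φ q)) hC haC (hpos p f hf) (hpos q f hf) ?_
      (fun g hg => hpos p g (hI (hSI hg))) (fun g hg => hpos q g (hI (hSI hg)))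
      (fun g hg => (Finset.mem_filter.1 hg).2) dist_nonneg (fun g hg => hYle p q g (hSI hg))
    have e1 : ∀ x, inner ℝ f x = ∑ g ∈ S, a g * inner ℝ g x := fun x => by
      rw [← haf, sum_inner]
      exact Finset.sum_congr rfl fun g _ => real_inner_smul_left _ _ _
    rw [e1, e1, sub_sub_sub_cancel_left, ← Finset.sum_sub_distrib]
    exact Finset.sum_congr rfl fun g _ => by ring
  have hdist : ∀ p ∈ A ∩ Metric.ball o R, ∀ q ∈ A ∩ Metric.ball o R,
      dist p q ≤ C.toNNReal * dist (Y p) (Y q) := fun p hp q hq => by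
    rw [Real.coe_toNNReal C (by linarith)]
    refine h.dist_le_of_abs_log_le hG (by positivity) fun f hf => abs_le.2 ⟨?_, ?_⟩
    · linarith [hone p hp.1 q f hf]
    · rw [dist_comm]
      exact hone q hq.1 p f hf
  have himg : Y '' (A ∩ Metric.ball o R) ⊆ Metric.closedBall (Y o) (2 * R) := by
    rintro _ ⟨p, hp, rfl⟩
    rw [Metric.mem_closedBall, dist_pi_le_iff (by positivity)]
    intro g
    have h1 := h.abs_log_sub_log_le (f := innerSL ℝ (g : Euc n)) (c := c g) (fun x hx => by
      rw [hG] at hx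
      exact hx g (hI g.2)) p o
    have h2 : dist p o < R := hp.2
    rw [Real.dist_eq]
    exact h1.trans (by linarith)
  have hvol : μH[(n : ℝ)] (Metric.closedBall (Y o) (2 * R)) = ENNReal.ofReal ((4 * R) ^ n) := by
    have hc : Fintype.card I = n := by rw [Fintype.card_coe, hcard]
    have := Real.volume_pi_closedBall (Y o) (r := 2 * R) (by positivity)
    rw [← hausdorffMeasure_pi_real, hc] at this
    rw [this]
    ring_nf
  calc μH[(n : ℝ)] (A ∩ Metric.ball o R)
      ≤ (C.toNNReal : ℝ≥0∞) ^ (n : ℝ) * μH[(n : ℝ)] (Y '' (A ∩ Metric.ball o R)) :=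
        hausdorffMeasure_le_of_dist_le hdist (Nat.cast_nonneg n)
    _ ≤ (C.toNNReal : ℝ≥0∞) ^ (n : ℝ) * ENNReal.ofReal ((4 * R) ^ n) := by
        rw [← hvol]
        gcongr
    _ = ENNReal.ofReal ((C * 4) ^ n * R ^ n) := by
        rw [ENNReal.rpow_natCast, ← ENNReal.ofReal.eq_1, ← ENNReal.ofReal_pow (by linarith),
          ← ENNReal.ofReal_mul (by positivity)]
        ring_nf

theorem limsup_lt_top_of_halfSpaces (h : IsHilbertGeometry Ω φ)
    (hG : Ω = {x | ∀ u ∈ G, inner ℝ u x < c u}) (o : X) :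
    Filter.limsup (fun R : ℝ => μH[(n : ℝ)] (Metric.ball o R) / ENNReal.ofReal (R ^ n))
      Filter.atTop < ⊤ := by
  classical
  obtain ⟨C, hC, hcoef⟩ := exists_uniform_coefficients G
  let T := G.powerset.filter fun I => I.card = n
  let A : Finset (Euc n) → Set X := fun I => {p | ∀ f ∈ G, f ∈ Submodule.span ℝ
      {g | g ∈ I ∧ c g - inner ℝ g (φ p) ≤ c f - inner ℝ f (φ p)}}
  have hcover : ∀ p, ∃ I ∈ T, p ∈ A I := fun p => by
    obtain ⟨I, hI, hind, hspan⟩ := exists_greedy_linearIndepOn G fun g => c g - inner ℝ g (φ p)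
    refine ⟨I, Finset.mem_filter.2 ⟨Finset.mem_powerset.2 hI, ?_⟩, hspan⟩
    have htop : Submodule.span ℝ (I : Set (Euc n)) = ⊤ := by
      rw [eq_top_iff, ← h.span_eq_top hG o, Submodule.span_le]
      exact fun f hf => Submodule.span_mono (fun g hg => hg.1) (hspan f hf)
    have h1 := finrank_span_finset_eq_card (R := ℝ) hind
    rw [htop, finrank_top, finrank_euclideanSpace_fin] at h1
    exact h1.symm
  have hbound : ∀ R : ℝ, 0 < R → μH[(n : ℝ)] (Metric.ball o R) / ENNReal.ofReal (R ^ n) ≤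
      T.card * ENNReal.ofReal ((C * 4) ^ n) := fun R hR => by
    refine ENNReal.div_le_of_le_mul ?_
    calc μH[(n : ℝ)] (Metric.ball o R)
        ≤ μH[(n : ℝ)] (⋃ I ∈ T, A I ∩ Metric.ball o R) := measure_mono fun p hp => by
          obtain ⟨I, hI, hpI⟩ := hcover p
          exact mem_biUnion hI ⟨hpI, hp⟩
      _ ≤ ∑ I ∈ T, μH[(n : ℝ)] (A I ∩ Metric.ball o R) := measure_biUnion_finset_le _ _
      _ ≤ ∑ _I ∈ T, ENNReal.ofReal ((C * 4) ^ n * R ^ n) := Finset.sum_le_sum fun I hI =>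
          h.hausdorffMeasure_inter_ball_le hG hC hcoef
            (Finset.mem_powerset.1 (Finset.mem_filter.1 hI).1) (Finset.mem_filter.1 hI).2 o hR
      _ = T.card * ENNReal.ofReal ((C * 4) ^ n) * ENNReal.ofReal (R ^ n) := by
          rw [Finset.sum_const, nsmul_eq_mul, ENNReal.ofReal_mul (by positivity), mul_assoc]
  refine (limsup_le_of_le (h := (eventually_gt_atTop 0).mono hbound)).trans_lt ?_
  exact ENNReal.mul_lt_top (ENNReal.natCast_lt_top _) ENNReal.ofReal_lt_top

end IsHilbertGeometry

/-- **Characterisation of polytopes by volume growth (Vernicos).**  For a Hilbert geometry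
`(Ω, d_Ω)` of dimension `n` (realized as an abstract metric space `X` identified with
`(Ω, d_Ω)` via `φ`), with `Vol` its `n`-dimensional Hausdorff measure, the upper asymptotic
volume `limsup_{R→∞} Vol(B_Ω(o,R))/Rⁿ` is finite if and only if `Ω` is the interior of a
bounded convex polytope. -/
theorem volume_growth_characterises_polytopes {n : ℕ}
    (Ω : Set (Euc n)) (hΩ : IsConvexDomain Ω)
    (d : Euc n → Euc n → ℝ) (hd : IsHilbertDist Ω d)
    (X : Type) [MetricSpace X] [MeasurableSpace X] [BorelSpace X]
    (φ : X → Euc n) (hφ : Set.BijOn φ Set.univ Ω)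
    (hdist : ∀ p q : X, dist p q = d (φ p) (φ q))
    (o : X) :
    Filter.limsup
        (fun R : ℝ => μH[(n : ℝ)] (Metric.ball o R) / ENNReal.ofReal (R ^ n))
        Filter.atTop < ⊤ ↔
      ∃ F : Finset (Euc n), Ω = interior (convexHull ℝ (↑F : Set (Euc n))) := by
  have h := hd.isHilbertGeometry hΩ hφ hdist
  constructor
  · intro hlt
    refine hΩ.exists_eq_interior_convexHull ?_
    by_contra hinf
    exact hlt.ne (h.limsup_eq_top_of_infinite hinf o)
  · rintro ⟨F, hF⟩
    obtain ⟨G, hG⟩ := exists_finset_interior_convexHull_eq F (hF ▸ h.map_mem o)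
    exact h.limsup_lt_top_of_halfSpaces (hF.trans hG) o
end
end

section
/- For each n there exists a constant aₙ > 0 such that for any Hilbert geometry (Ω, d_Ω) of dimension n whose closure admits at least k extremal points, one has aₙ · k ≤ limsup_{R→∞} Vol(B_Ω(o,R))/Rⁿ for any o ∈ Ω, where Vol is the n-dimensional Hausdorff measure of the metric space (Ω, d_Ω) and B_Ω(o,R) is the metric ball of radius R centered at o. -/
open Set Filter MeasureTheory

noncomputable section

/-- Any set of finite Hausdorff measure admits fine covers whose sums are close to the measure. -/
theorem exists_cover_tsum_le {X : Type*} [EMetricSpace X] [MeasurableSpace X] [BorelSpace X]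
    (d : ℝ) (S : Set X) {r ε : ENNReal} (hr : 0 < r) (hε : ε ≠ 0) (hS : μH[d] S ≠ ⊤) :
    ∃ E : ℕ → Set X, S ⊆ ⋃ i, E i ∧ (∀ i, Metric.ediam (E i) ≤ r) ∧
      ∑' i, ⨆ _ : (E i).Nonempty, Metric.ediam (E i) ^ d ≤ μH[d] S + ε := by
  have h1 := Measure.hausdorffMeasure_apply d S
  have h2 := ENNReal.lt_add_right hS hε
  have h3 := (le_iSup₂ (f := fun (r : ENNReal) (_ : 0 < r) => ⨅ (t : ℕ → Set X),
      ⨅ (_ : S ⊆ ⋃ n, t n), ⨅ (_ : ∀ (n : ℕ), Metric.ediam (t n) ≤ r),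
      ∑' (n : ℕ), ⨆ (_ : (t n).Nonempty), Metric.ediam (t n) ^ d) r hr).trans h1.ge
  have h4 := lt_of_le_of_lt h3 h2
  simp only [iInf_lt_iff] at h4
  obtain ⟨E, hE, hd, h⟩ := h4
  exact ⟨E, hE, hd, h.le⟩

/-- **Eilenberg's inequality**, for slices of `m`-dimensional measure at least `M`. -/
theorem mul_volume_le_hausdorffMeasure_of_slices {X : Type*} [EMetricSpace X] [MeasurableSpace X]
    [BorelSpace X] {f : X → ℝ} (hf : LipschitzWith 1 f) (m : ℕ) (S : Set X) {I : Set ℝ}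
    (hI : MeasurableSet I) {M : ENNReal} (hM : ∀ t ∈ I, M ≤ μH[(m : ℝ)] (S ∩ f ⁻¹' {t})) :
    M * volume I ≤ μH[((m + 1 : ℕ) : ℝ)] S := by
  by_cases hS : μH[((m + 1 : ℕ) : ℝ)] S = ⊤
  · exact hS ▸ le_top
  let r : ℕ → ENNReal := fun j => ((j : ENNReal) + 1)⁻¹
  have hr0 : ∀ j, 0 < r j := fun j => by
    simp only [r, ENNReal.inv_pos]
    exact ENNReal.add_ne_top.2 ⟨ENNReal.natCast_ne_top j, ENNReal.one_ne_top⟩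
  have hr : Tendsto r atTop (nhds 0) := by
    have h := (tendsto_add_atTop_iff_nat 1).2 ENNReal.tendsto_inv_nat_nhds_zero
    simpa [r] using h
  choose E hSE hEr hE using fun j => exists_cover_tsum_le ((m + 1 : ℕ) : ℝ) S (hr0 j) (hr0 j).ne' hS
  let g : ℕ → ℝ → ENNReal := fun j t =>
    ∑' i, (closure (f '' E j i)).indicator (fun _ => Metric.ediam (E j i) ^ m) t
  have hgm : ∀ j, Measurable (g j) := fun j =>
    Measurable.tsum fun i => measurable_const.indicator isClosed_closure.measurableSet
  have hgint : ∀ j, ∫⁻ t, g j t ≤ μH[((m + 1 : ℕ) : ℝ)] S + r j := by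
    intro j
    refine le_trans ?_ (hE j)
    rw [lintegral_tsum fun i =>
      (measurable_const.indicator isClosed_closure.measurableSet).aemeasurable]
    refine ENNReal.tsum_le_tsum fun i => ?_
    rw [lintegral_indicator isClosed_closure.measurableSet, setLIntegral_const]
    rcases (E j i).eq_empty_or_nonempty with h | h
    · simp [h]
    · rw [ciSup_pos h, ENNReal.rpow_natCast, pow_succ]
      gcongr
      refine (Real.volume_le_diam _).trans ?_
      rw [Metric.ediam_closure]
      simpa using hf.ediam_image_le (E j i)
  have hlow : ∀ t ∈ I, M ≤ liminf (fun j => g j t) atTop := by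
    intro t ht
    refine (hM t ht).trans ?_
    let ι : ℕ → Type := fun j => {i : ℕ // (E j i ∩ f ⁻¹' {t}).Nonempty}
    have key := Measure.hausdorffMeasure_le_liminf_tsum (X := X) (ι := ι) (m : ℝ)
      (S ∩ f ⁻¹' {t}) (l := atTop) r hr (fun j i => E j i.1 ∩ f ⁻¹' {t})
      (Eventually.of_forall fun j i => (Metric.ediam_mono inter_subset_left).trans (hEr j i.1))
      (Eventually.of_forall fun j x hx => by
        obtain ⟨i, hi⟩ := mem_iUnion.1 (hSE j hx.1)
        exact mem_iUnion.2 ⟨⟨i, x, hi, hx.2⟩, hi, hx.2⟩)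
    refine key.trans (liminf_le_liminf (Eventually.of_forall fun j => ?_))
    refine le_trans ?_ (ENNReal.tsum_comp_le_tsum_of_injective
      (f := fun i : ι j => i.1) Subtype.val_injective _)
    refine ENNReal.tsum_le_tsum fun i => ?_
    obtain ⟨x, hx, hxt⟩ := i.2
    have hmem : t ∈ closure (f '' E j i.1) := subset_closure ⟨x, hx, hxt⟩
    rw [indicator_of_mem hmem, ENNReal.rpow_natCast]
    gcongr
    exact inter_subset_left
  calc M * volume I = ∫⁻ _ in I, M := by rw [setLIntegral_const]
    _ ≤ ∫⁻ t in I, liminf (fun j => g j t) atTop := setLIntegral_mono' hI hlow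
    _ ≤ ∫⁻ t, liminf (fun j => g j t) atTop := setLIntegral_le_lintegral _ _
    _ ≤ liminf (fun j => ∫⁻ t, g j t) atTop := lintegral_liminf_le hgm
    _ ≤ liminf (fun j => μH[((m + 1 : ℕ) : ℝ)] S + r j) atTop :=
        liminf_le_liminf (Eventually.of_forall hgint)
    _ = μH[((m + 1 : ℕ) : ℝ)] S := by
        have : Tendsto (fun j => μH[((m + 1 : ℕ) : ℝ)] S + r j) atTop
            (nhds (μH[((m + 1 : ℕ) : ℝ)] S + 0)) := tendsto_const_nhds.add hr
        rw [this.liminf_eq, add_zero]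

/-- Every ray issued from a point of a bounded open set leaves it through the frontier. -/
theorem exists_add_smul_mem_frontier {E : Type*} [NormedAddCommGroup E] [NormedSpace ℝ E]
    {Ω : Set E} (hΩ : IsOpen Ω) (hb : Bornology.IsBounded Ω) {o v : E} (ho : o ∈ Ω) (hv : v ≠ 0) :
    ∃ t : ℝ, 0 < t ∧ o + t • v ∈ frontier Ω := by
  obtain ⟨C, hC⟩ := hb.exists_norm_le
  have hv' : 0 < ‖v‖ := norm_pos_iff.2 hv
  let c : ℝ → E := fun t => o + t • v
  have hc : Continuous c := by fun_prop
  let A : Set E := c '' Ici 0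
  have hA : IsPreconnected A := isPreconnected_Ici.image _ hc.continuousOn
  by_contra! h
  have hfr : Disjoint A (frontier Ω) := by
    rw [disjoint_left]
    rintro _ ⟨t, ht, rfl⟩ hx
    rcases (mem_Ici.1 ht).eq_or_lt with rfl | ht
    · rw [hΩ.frontier_eq] at hx
      exact hx.2 (by simpa [c] using ho)
    · exact h t ht hx
  have hsub : A ⊆ Ω := by
    refine hA.subset_left_of_subset_union hΩ isClosed_closure.isOpen_compl
      (disjoint_left.2 fun x hx hx' => hx' (subset_closure hx)) ?_ ⟨o, ⟨0, by simp, by simp [c]⟩, ho⟩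
    intro x hx
    by_cases hxo : x ∈ Ω
    · exact Or.inl hxo
    · refine Or.inr fun hx' => disjoint_left.1 hfr hx ?_
      rw [hΩ.frontier_eq]
      exact ⟨hx', hxo⟩
  have hT : 0 ≤ (C + ‖o‖ + 1) / ‖v‖ := by
    have := (norm_nonneg o).trans (hC o ho)
    positivity
  have h1 := hC _ (hsub ⟨(C + ‖o‖ + 1) / ‖v‖, hT, rfl⟩)
  have h2 : ‖((C + ‖o‖ + 1) / ‖v‖) • v‖ = C + ‖o‖ + 1 := by
    rw [norm_smul, Real.norm_of_nonneg hT, div_mul_cancel₀ _ hv'.ne']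
  have h3 : ‖((C + ‖o‖ + 1) / ‖v‖) • v‖ ≤ ‖c ((C + ‖o‖ + 1) / ‖v‖)‖ + ‖o‖ := by
    have := norm_sub_le (c ((C + ‖o‖ + 1) / ‖v‖)) o
    simpa [c] using this
  linarith

/-- The Hilbert distance in terms of the parameters of the endpoints of the chord. -/
theorem IsHilbertDist.eq_log {n : ℕ} {Ω : Set (Euc n)} {d : Euc n → Euc n → ℝ}
    (hd : IsHilbertDist Ω d) {p q : Euc n} (hp : p ∈ Ω) (hq : q ∈ Ω) (hpq : p ≠ q) {s t : ℝ}
    (hs : s < 0) (ht : 1 < t) (ha : p + s • (q - p) ∈ frontier Ω)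
    (hb : p + t • (q - p) ∈ frontier Ω) :
    d p q = 1 / 2 * Real.log ((1 - s) / (-s) * (t / (t - 1))) := by
  have hv : ‖q - p‖ ≠ 0 := norm_ne_zero_iff.2 (sub_ne_zero.2 hpq.symm)
  rw [hd.2 p hp q hq hpq _ _ ha hb ⟨s, t, hs, ht, rfl, rfl⟩]
  have e1 : q - (p + s • (q - p)) = (1 - s) • (q - p) := by module
  have e2 : p - (p + s • (q - p)) = (-s) • (q - p) := by module
  have e3 : p - (p + t • (q - p)) = (-t) • (q - p) := by module
  have e4 : q - (p + t • (q - p)) = -(t - 1) • (q - p) := by module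
  rw [e1, e2, e3, e4]
  simp only [norm_smul, Real.norm_eq_abs, abs_neg]
  rw [abs_of_pos (by linarith : 0 < 1 - s), abs_of_neg hs, abs_of_pos (by linarith : 0 < t),
    abs_of_pos (by linarith : 0 < t - 1), mul_div_mul_right _ _ hv, mul_div_mul_right _ _ hv]

/-- The logarithm `½ log ((α₁ - g₁) / (α₂ - g₂))` of a quotient of affine functions. -/
def logRatio {E : Type*} [NormedAddCommGroup E] [NormedSpace ℝ E] (g₁ g₂ : E →L[ℝ] ℝ) (α₁ α₂ : ℝ)
    (x : E) : ℝ :=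
  1 / 2 * Real.log ((α₁ - g₁ x) / (α₂ - g₂ x))

theorem logRatio_sub {E : Type*} [NormedAddCommGroup E] [NormedSpace ℝ E] {g₁ g₂ : E →L[ℝ] ℝ}
    {α₁ α₂ : ℝ} {p q : E} (hp₁ : g₁ p < α₁) (hp₂ : g₂ p < α₂) (hq₁ : g₁ q < α₁) (hq₂ : g₂ q < α₂) :
    logRatio g₁ g₂ α₁ α₂ q - logRatio g₁ g₂ α₁ α₂ p =
      1 / 2 * Real.log ((α₁ - g₁ q) / (α₁ - g₁ p) * ((α₂ - g₂ p) / (α₂ - g₂ q))) := by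
  have h1 := (sub_pos.2 hp₁).ne'
  have h2 := (sub_pos.2 hp₂).ne'
  have h3 := (sub_pos.2 hq₁).ne'
  have h4 := (sub_pos.2 hq₂).ne'
  rw [logRatio, logRatio, Real.log_div h3 h4, Real.log_div h1 h2,
    Real.log_mul (div_ne_zero h3 h1) (div_ne_zero h2 h4), Real.log_div h3 h1, Real.log_div h2 h4]
  ring

theorem le_of_mem_closure_of_lt {E : Type*} [NormedAddCommGroup E] [NormedSpace ℝ E] {Ω : Set E}
    {g : E →L[ℝ] ℝ} {α : ℝ} (h : ∀ x ∈ Ω, g x < α) {x : E} (hx : x ∈ closure Ω) : g x ≤ α :=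
  closure_minimal (fun _ hy => (h _ hy).le) (isClosed_le g.continuous continuous_const) hx

/-- Logarithms of quotients of affine functions positive on `Ω` are `1`-Lipschitz for the Hilbert
distance. -/
theorem IsHilbertDist.logRatio_sub_le {n : ℕ} {Ω : Set (Euc n)} {d : Euc n → Euc n → ℝ}
    (hΩ : IsConvexDomain Ω) (hd : IsHilbertDist Ω d) {g₁ g₂ : Euc n →L[ℝ] ℝ} {α₁ α₂ : ℝ}
    (h₁ : ∀ x ∈ Ω, g₁ x < α₁) (h₂ : ∀ x ∈ Ω, g₂ x < α₂) {p q : Euc n} (hp : p ∈ Ω) (hq : q ∈ Ω) :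
    logRatio g₁ g₂ α₁ α₂ q - logRatio g₁ g₂ α₁ α₂ p ≤ d p q := by
  obtain ⟨-, hop, hbd, hconv⟩ := hΩ
  rcases eq_or_ne p q with rfl | hpq
  · rw [hd.1 p hp, sub_self]
  have hv : q - p ≠ 0 := sub_ne_zero.2 hpq.symm
  obtain ⟨t, ht0, ht⟩ := exists_add_smul_mem_frontier hop hbd hp hv
  obtain ⟨s, hs0, hs⟩ := exists_add_smul_mem_frontier hop hbd hp (neg_ne_zero.2 hv)
  rw [smul_neg, ← neg_smul] at hs
  have ht1 : 1 < t := by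
    by_contra! hle
    rw [hop.frontier_eq] at ht
    exact ht.2 (hconv.add_smul_sub_mem hp hq ⟨ht0.le, hle⟩)
  rw [hd.eq_log hp hq hpq (neg_neg_of_pos hs0) ht1 hs ht,
    logRatio_sub (h₁ p hp) (h₂ p hp) (h₁ q hq) (h₂ q hq)]
  have a1 := sub_pos.2 (h₁ p hp)
  have a2 := sub_pos.2 (h₂ p hp)
  have a3 := sub_pos.2 (h₁ q hq)
  have a4 := sub_pos.2 (h₂ q hq)
  have b1 := le_of_mem_closure_of_lt h₁ (frontier_subset_closure hs)
  have b2 := le_of_mem_closure_of_lt h₂ (frontier_subset_closure ht)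
  simp only [map_add, map_smul, map_sub, smul_eq_mul] at b1 b2
  have c1 : (α₁ - g₁ q) / (α₁ - g₁ p) ≤ (1 - -s) / (- -s) := by
    rw [div_le_div_iff₀ a1 (by linarith)]
    nlinarith
  have c2 : (α₂ - g₂ p) / (α₂ - g₂ q) ≤ t / (t - 1) := by
    rw [div_le_div_iff₀ a4 (by linarith)]
    nlinarith
  have c3 : 0 < (α₁ - g₁ q) / (α₁ - g₁ p) := by positivity
  have c4 : 0 < (α₂ - g₂ p) / (α₂ - g₂ q) := by positivity
  have c5 : 0 ≤ (1 - -s) / (- -s) := c3.le.trans c1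
  have : Real.log ((α₁ - g₁ q) / (α₁ - g₁ p) * ((α₂ - g₂ p) / (α₂ - g₂ q))) ≤
      Real.log ((1 - -s) / (- -s) * (t / (t - 1))) := by gcongr
  linarith

/-- Along a chord, `logRatio` of functions vanishing at its endpoints realizes the distance. -/
theorem IsHilbertDist.eq_logRatio_sub {n : ℕ} {Ω : Set (Euc n)} {d : Euc n → Euc n → ℝ}
    (hd : IsHilbertDist Ω d) {g₁ g₂ : Euc n →L[ℝ] ℝ} {o v : Euc n} {r s t : ℝ} (ho : o ∈ Ω)
    (hx : o + r • v ∈ Ω) (hv : v ≠ 0) (hsr : s < r) (hr : r < 0) (ht : 0 < t)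
    (ha : o + s • v ∈ frontier Ω) (hb : o + t • v ∈ frontier Ω)
    (h₁ : ∀ x ∈ Ω, g₁ x < g₁ (o + s • v)) (h₂ : ∀ x ∈ Ω, g₂ x < g₂ (o + t • v)) :
    d o (o + r • v) = logRatio g₁ g₂ (g₁ (o + s • v)) (g₂ (o + t • v)) o -
      logRatio g₁ g₂ (g₁ (o + s • v)) (g₂ (o + t • v)) (o + r • v) := by
  have hne : o ≠ o + r • v := by simpa using ⟨hr.ne, hv⟩
  rw [logRatio_sub (h₁ _ hx) (h₂ _ hx) (h₁ o ho) (h₂ o ho)]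
  have e : ∀ u : ℝ, o + (u / r) • (o + r • v - o) = o + u • v := fun u => by
    rw [add_sub_cancel_left, smul_smul, div_mul_cancel₀ _ hr.ne]
  rw [hd.eq_log ho hx hne (s := t / r) (t := s / r) (div_neg_of_pos_of_neg ht hr)
    ((one_lt_div_of_neg hr).2 hsr) (by rwa [e]) (by rwa [e])]
  have k1 := h₁ o ho
  have k2 := h₂ o ho
  simp only [map_add, map_smul, smul_eq_mul] at k1 k2 ⊢
  have hg1 : g₁ v ≠ 0 := by rintro h; simp [h] at k1
  have hg2 : g₂ v ≠ 0 := by rintro h; simp [h] at k2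
  have f1 : g₁ o + s * g₁ v - g₁ o = s * g₁ v := by ring
  have f2 : g₁ o + s * g₁ v - (g₁ o + r * g₁ v) = (s - r) * g₁ v := by ring
  have f3 : g₂ o + t * g₂ v - g₂ o = t * g₂ v := by ring
  have f4 : g₂ o + t * g₂ v - (g₂ o + r * g₂ v) = (t - r) * g₂ v := by ring
  rw [f1, f2, f3, f4, mul_div_mul_right _ _ hg1, mul_div_mul_right _ _ hg2]
  have hr' := hr.ne
  have ht' := ht.ne'
  have e₁ : (1 - t / r) / (-(t / r)) = (t - r) / t := by
    rw [one_sub_div hr', ← neg_div, div_div_div_cancel_right₀ hr', ← neg_div_neg_eq, neg_sub,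
      neg_neg]
  have e₂ : s / r / (s / r - 1) = s / (s - r) := by
    rw [div_sub_one hr', div_div_div_cancel_right₀ hr']
  rw [e₁, e₂, mul_comm ((t - r) / t)]

/-- The points of `Ω` where a level of `logRatio` meets the half-chord. -/
theorem exists_logRatio_eq {n : ℕ} {Ω : Set (Euc n)} (hΩ : IsConvexDomain Ω)
    {g₁ g₂ : Euc n →L[ℝ] ℝ} {o v : Euc n} {s t τ : ℝ} (ho : o ∈ Ω) (hs : s < 0) (ht : 0 < t)
    (ha : o + s • v ∈ closure Ω)
    (h₁ : ∀ x ∈ Ω, g₁ x < g₁ (o + s • v)) (h₂ : ∀ x ∈ Ω, g₂ x < g₂ (o + t • v))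
    (hτ : τ < logRatio g₁ g₂ (g₁ (o + s • v)) (g₂ (o + t • v)) o) :
    ∃ r : ℝ, s < r ∧ r < 0 ∧ o + r • v ∈ Ω ∧
      logRatio g₁ g₂ (g₁ (o + s • v)) (g₂ (o + t • v)) (o + r • v) = τ := by
  obtain ⟨-, hop, -, hconv⟩ := hΩ
  have k1 := h₁ o ho
  have k2 := h₂ o ho
  simp only [logRatio] at hτ ⊢
  simp only [map_add, map_smul, smul_eq_mul] at k1 k2 hτ ⊢
  have hα : g₁ v < 0 := by nlinarith
  have hβ : 0 < g₂ v := by nlinarith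
  set c := Real.exp (2 * τ) with hc
  have hc0 : 0 < c := Real.exp_pos _
  have hlt : c < (g₁ o + s * g₁ v - g₁ o) / (g₂ o + t * g₂ v - g₂ o) := by
    have h0 : 0 < (g₁ o + s * g₁ v - g₁ o) / (g₂ o + t * g₂ v - g₂ o) :=
      div_pos (by linarith) (by linarith)
    rw [hc, ← Real.lt_log_iff_exp_lt h0]
    linarith
  rw [lt_div_iff₀ (by linarith)] at hlt
  have hD : 0 < c * g₂ v - g₁ v := by
    have := mul_pos hc0 hβ
    linarith
  obtain ⟨r, hr⟩ : ∃ r, r * (c * g₂ v - g₁ v) = c * t * g₂ v - s * g₁ v :=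
    ⟨_, div_mul_cancel₀ _ hD.ne'⟩
  have hr0 : r < 0 := by nlinarith
  have hcts : 0 < c * g₂ v * (t - s) := by
    have := mul_pos hc0 hβ
    have : 0 < t - s := by linarith
    positivity
  have hsr : s < r := by
    by_contra! hle
    nlinarith
  refine ⟨r, hsr, hr0, ?_, ?_⟩
  · have := hconv.combo_interior_closure_mem_interior (x := o) (y := o + s • v)
      (a := 1 - r / s) (b := r / s) (by rwa [hop.interior_eq]) ha
      (by rw [sub_pos, div_lt_one_of_neg hs]; exact hsr)
      (div_nonneg_of_nonpos hr0.le hs.le) (by ring)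
    rw [hop.interior_eq] at this
    convert this using 1
    have : r • v = (r / s) • (s • v) := by rw [smul_smul, div_mul_cancel₀ _ hs.ne]
    rw [this]
    module
  · have : (g₁ o + s * g₁ v - (g₁ o + r * g₁ v)) / (g₂ o + t * g₂ v - (g₂ o + r * g₂ v)) = c := by
      rw [div_eq_iff (by nlinarith)]
      linarith
    rw [this, hc, Real.log_exp]
    ring

/-- The metric space `X` is identified through `φ` with the Hilbert geometry `(Ω, d)`. -/
structure IsHilbertModel {n : ℕ} (Ω : Set (Euc n)) (d : Euc n → Euc n → ℝ) {X : Type*}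
    [MetricSpace X] (φ : X → Euc n) : Prop where
  convexDomain : IsConvexDomain Ω
  hilbertDist : IsHilbertDist Ω d
  mem : ∀ x, φ x ∈ Ω
  exists_eq : ∀ p ∈ Ω, ∃ x, φ x = p
  dist_eq : ∀ x y, dist x y = d (φ x) (φ y)

theorem IsHilbertModel.lipschitzWith_logRatio {n : ℕ} {Ω : Set (Euc n)}
    {d : Euc n → Euc n → ℝ} {X : Type*} [MetricSpace X] {φ : X → Euc n}
    (h : IsHilbertModel Ω d φ) {g₁ g₂ : Euc n →L[ℝ] ℝ} {α₁ α₂ : ℝ}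
    (h₁ : ∀ x ∈ Ω, g₁ x < α₁) (h₂ : ∀ x ∈ Ω, g₂ x < α₂) :
    LipschitzWith 1 fun x => logRatio g₁ g₂ α₁ α₂ (φ x) :=
  LipschitzWith.of_le_add fun x y => by
    have := h.hilbertDist.logRatio_sub_le h.convexDomain h₁ h₂ (h.mem y) (h.mem x)
    rw [← h.dist_eq, dist_comm] at this
    linarith

theorem exists_submodule_finrank_eq {V : Type*} [AddCommGroup V] [Module ℝ V]
    [FiniteDimensional ℝ V] {W : Submodule ℝ V} {m : ℕ} (hW : Module.finrank ℝ W = m + 1)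
    {v : V} (hv : v ∈ W) (g : V →ₗ[ℝ] ℝ) (hg : g v ≠ 0) :
    ∃ W' : Submodule ℝ V, Module.finrank ℝ W' = m ∧ ∀ x ∈ W', x ∈ W ∧ g x = 0 := by
  have hne : g.domRestrict W ≠ 0 := fun h => hg (LinearMap.congr_fun h ⟨v, hv⟩)
  refine ⟨(LinearMap.ker (g.domRestrict W)).map W.subtype, ?_, ?_⟩
  · have := Module.Dual.finrank_ker_add_one_of_ne_zero (f := g.domRestrict W) hne
    rw [Submodule.finrank_map_subtype_eq]
    omega
  · rintro _ ⟨y, hy, rfl⟩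
    exact ⟨y.2, hy⟩

/-- If all balls of the `m`-dimensional sections have volume at least `c * R ^ m`, then in a section
of dimension `m + 1` the part of a ball close to an endpoint of a chord is large. -/
theorem IsHilbertModel.le_hausdorffMeasure_cap {n : ℕ} {Ω : Set (Euc n)}
    {d : Euc n → Euc n → ℝ} {X : Type*} [MetricSpace X] [MeasurableSpace X] [BorelSpace X]
    {φ : X → Euc n} (h : IsHilbertModel Ω d φ) {m : ℕ} {c : ℝ} (hc : 0 ≤ c)
    (hm : ∀ (x : X) (W : Submodule ℝ (Euc n)), Module.finrank ℝ W = m → ∀ R : ℝ, 0 < R →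
      ENNReal.ofReal (c * R ^ m) ≤ μH[(m : ℝ)] {y | φ y - φ x ∈ W ∧ dist x y < R})
    (o : X) {W : Submodule ℝ (Euc n)} (hW : Module.finrank ℝ W = m + 1) {v : Euc n} (hv : v ∈ W)
    {g₁ g₂ : Euc n →L[ℝ] ℝ} {s t : ℝ} (hs : s < 0) (ht : 0 < t)
    (ha : φ o + s • v ∈ frontier Ω) (hb : φ o + t • v ∈ frontier Ω)
    (h₁ : ∀ x ∈ Ω, g₁ x < g₁ (φ o + s • v)) (h₂ : ∀ x ∈ Ω, g₂ x < g₂ (φ o + t • v))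
    {R T : ℝ} (hT : 0 ≤ T) (hR : T < R) :
    ENNReal.ofReal (c * ((R - T) / 2) ^ (m + 1)) ≤ μH[((m + 1 : ℕ) : ℝ)]
      {y | φ y - φ o ∈ W ∧ dist o y < R ∧
        logRatio g₁ g₂ (g₁ (φ o + s • v)) (g₂ (φ o + t • v)) (φ y) <
          logRatio g₁ g₂ (g₁ (φ o + s • v)) (g₂ (φ o + t • v)) (φ o) - T} := by
  have k1 := h₁ _ (h.mem o)
  have k2 := h₂ _ (h.mem o)
  set α₁ := g₁ (φ o + s • v) with hα₁
  set α₂ := g₂ (φ o + t • v) with hα₂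
  set f : Euc n → ℝ := logRatio g₁ g₂ α₁ α₂ with hf
  have hv0 : v ≠ 0 := by
    rintro rfl
    simp [hα₁] at k1
  have hR2 : 0 < (R - T) / 2 := by linarith
  have key := mul_volume_le_hausdorffMeasure_of_slices (h.lipschitzWith_logRatio h₁ h₂) m
    {y | φ y - φ o ∈ W ∧ dist o y < R ∧ f (φ y) < f (φ o) - T}
    (I := Ioo (f (φ o) - (T + R) / 2) (f (φ o) - T)) measurableSet_Ioo
    (M := ENNReal.ofReal (c * ((R - T) / 2) ^ m)) ?_
  · rw [Real.volume_Ioo, ← ENNReal.ofReal_mul (by positivity)] at key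
    convert key using 2
    ring
  rintro τ ⟨hτ₁, hτ₂⟩
  obtain ⟨r, hsr, hr, hx, hfx⟩ := exists_logRatio_eq h.convexDomain (h.mem o) hs ht
    (frontier_subset_closure ha) h₁ h₂ (τ := τ) (hτ₂.trans_le (sub_le_self _ hT))
  have hdist := h.hilbertDist.eq_logRatio_sub (h.mem o) hx hv0 hsr hr ht ha hb h₁ h₂
  rw [hfx] at hdist
  obtain ⟨x, hφx⟩ := h.exists_eq _ hx
  rw [← hφx, ← h.dist_eq] at hdist
  have hg : ((g₁ : Euc n →ₗ[ℝ] ℝ) - Real.exp (2 * τ) • (g₂ : Euc n →ₗ[ℝ] ℝ)) v ≠ 0 := by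
    simp only [hα₁, hα₂, map_add, map_smul, smul_eq_mul] at k1 k2
    have hα : g₁ v < 0 := by nlinarith
    have hβ : 0 < g₂ v := by nlinarith
    have := mul_pos (Real.exp_pos (2 * τ)) hβ
    simp only [LinearMap.sub_apply, LinearMap.smul_apply, ContinuousLinearMap.coe_coe, smul_eq_mul]
    linarith
  obtain ⟨W', hW', hmem⟩ := exists_submodule_finrank_eq hW hv _ hg
  refine (hm x W' hW' _ hR2).trans (measure_mono ?_)
  rintro y ⟨hyW, hy⟩
  obtain ⟨hyW, hyg⟩ := hmem _ hyW
  have hfy : f (φ y) = τ := by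
    rw [← hφx] at hfx hx
    have p1 := sub_pos.2 (h₁ _ hx)
    have p2 := sub_pos.2 (h₂ _ hx)
    have q2 := sub_pos.2 (h₂ _ (h.mem y))
    have hrat : (α₁ - g₁ (φ x)) / (α₂ - g₂ (φ x)) = Real.exp (2 * τ) := by
      rw [← hfx, logRatio, ← mul_assoc, mul_one_div_cancel two_ne_zero, one_mul,
        Real.exp_log (div_pos p1 p2)]
    rw [div_eq_iff p2.ne'] at hrat
    simp only [LinearMap.sub_apply, LinearMap.smul_apply, ContinuousLinearMap.coe_coe, smul_eq_mul,
      map_sub] at hyg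
    have : (α₁ - g₁ (φ y)) / (α₂ - g₂ (φ y)) = Real.exp (2 * τ) := by
      rw [div_eq_iff q2.ne']
      linarith
    rw [hf, logRatio, this, Real.log_exp]
    ring
  refine ⟨⟨?_, ?_, ?_⟩, hfy⟩
  · have : φ y - φ o = (φ y - φ x) + r • v := by rw [hφx]; module
    rw [this]
    exact W.add_mem hyW (W.smul_mem _ hv)
  · have := dist_triangle o x y
    linarith
  · rwa [hfy]

/-- Volume of balls in Hilbert geometries grows at least polynomially, uniformly in the geometry. -/
theorem exists_le_hausdorffMeasure_section_ball (m : ℕ) :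
    ∃ c : ℝ, 0 < c ∧ ∀ (n : ℕ) (Ω : Set (Euc n)) (d : Euc n → Euc n → ℝ) (X : Type)
      [MetricSpace X] [MeasurableSpace X] [BorelSpace X] (φ : X → Euc n), IsHilbertModel Ω d φ →
      ∀ (x : X) (W : Submodule ℝ (Euc n)), Module.finrank ℝ W = m → ∀ R : ℝ, 0 < R →
        ENNReal.ofReal (c * R ^ m) ≤ μH[(m : ℝ)] {y | φ y - φ x ∈ W ∧ dist x y < R} := by
  induction m with
  | zero =>
    refine ⟨1, one_pos, fun n Ω d X _ _ _ φ h x W hW R hR => ?_⟩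
    simpa using Measure.one_le_hausdorffMeasure_zero_of_nonempty
      (s := {y | φ y - φ x ∈ W ∧ dist x y < R}) ⟨x, by simpa using hR⟩
  | succ m ih =>
    obtain ⟨c, hc, ih⟩ := ih
    refine ⟨c / 2 ^ (m + 1), by positivity, fun n Ω d X _ _ _ φ h x W hW R hR => ?_⟩
    obtain ⟨-, hop, hbd, hconv⟩ := h.convexDomain
    obtain ⟨v, hv, hv0⟩ := W.exists_mem_ne_zero_of_ne_bot (by
      rintro rfl
      simp at hW)
    obtain ⟨t, ht, hb⟩ := exists_add_smul_mem_frontier hop hbd (h.mem x) hv0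
    obtain ⟨s, hs, ha⟩ := exists_add_smul_mem_frontier hop hbd (h.mem x) (neg_ne_zero.2 hv0)
    rw [smul_neg, ← neg_smul] at ha
    obtain ⟨g₁, h₁⟩ := geometric_hahn_banach_open_point hconv hop
      (hop.frontier_eq ▸ ha : φ x + -s • v ∈ closure Ω \ Ω).2
    obtain ⟨g₂, h₂⟩ := geometric_hahn_banach_open_point hconv hop
      (hop.frontier_eq ▸ hb : φ x + t • v ∈ closure Ω \ Ω).2
    have key := h.le_hausdorffMeasure_cap hc.le (ih n Ω d X φ h) x hW hv (neg_neg_of_pos hs) ht ha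
      hb h₁ h₂ le_rfl hR
    refine le_trans (le_of_eq ?_) (key.trans (measure_mono fun y hy => ⟨hy.1, hy.2.1⟩))
    rw [sub_zero, div_pow]
    congr 1
    ring

/-- Every open half-space meeting a compact set contains an exposed point of it. -/
theorem IsCompact.exists_mem_exposedPoints_lt {E : Type*} [NormedAddCommGroup E]
    [InnerProductSpace ℝ E] [CompleteSpace E] {K : Set E} (hK : IsCompact K) {x : E} (hx : x ∈ K)
    (g : E →L[ℝ] ℝ) {u : ℝ} (hu : g x < u) : ∃ y ∈ K.exposedPoints ℝ, g y < u := by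
  obtain ⟨C, hC⟩ := hK.isBounded.exists_norm_le
  have hC0 : 0 ≤ C := (norm_nonneg x).trans (hC x hx)
  set w := (InnerProductSpace.toDual ℝ E).symm g with hw
  have hgw : ∀ y, inner ℝ y w = g y := fun y => by
    rw [real_inner_comm, hw, InnerProductSpace.toDual_symm_apply]
  set N : ℝ := (C ^ 2 + 1) / (2 * (u - g x)) with hN
  have hux : 0 < 2 * (u - g x) := by linarith
  have hN0 : 0 < N := by positivity
  have hNu : N * (2 * (u - g x)) = C ^ 2 + 1 := div_mul_cancel₀ _ hux.ne'
  obtain ⟨y, hy, hmax⟩ := hK.exists_isMaxOn ⟨x, hx⟩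
    (f := fun y => ‖y - N • w‖) (by fun_prop)
  have hmax : ∀ x ∈ K, ‖x - N • w‖ ^ 2 ≤ ‖y - N • w‖ ^ 2 := fun x hx => by
    have := hmax hx
    simp only [mem_ofPred_eq] at this
    gcongr
  have hexp : ∀ a : E, ‖a - N • w‖ ^ 2 = ‖a‖ ^ 2 - 2 * (N * g a) + ‖N • w‖ ^ 2 := fun a => by
    rw [norm_sub_sq_real, inner_smul_right, hgw]
  refine ⟨y, ⟨hy, InnerProductSpace.toDual ℝ E (y - N • w), fun z hz => ?_⟩, ?_⟩
  · simp only [InnerProductSpace.toDual_apply_apply]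
    have h1 := hmax z hz
    have h2 : ‖z - y‖ ^ 2 = ‖z - N • w‖ ^ 2 - ‖y - N • w‖ ^ 2
        - 2 * (inner ℝ (y - N • w) z - inner ℝ (y - N • w) y) := by
      have : z - N • w = (z - y) + (y - N • w) := by abel
      rw [this, norm_add_sq_real, ← inner_sub_right, real_inner_comm]
      ring
    refine ⟨by nlinarith [sq_nonneg ‖z - y‖], fun hle => ?_⟩
    have : ‖z - y‖ ^ 2 = 0 := le_antisymm (by linarith) (sq_nonneg _)
    exact sub_eq_zero.1 (norm_eq_zero.1 (pow_eq_zero_iff two_ne_zero |>.1 this))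
  · have h1 := hmax x hx
    rw [hexp, hexp] at h1
    have h2 : ‖y‖ ^ 2 ≤ C ^ 2 := by
      gcongr
      exact hC y hy
    nlinarith [sq_nonneg ‖x‖]

/-- A compact convex set with `k` extreme points has `k` exposed points. -/
theorem exists_finset_subset_exposedPoints {E : Type*} [NormedAddCommGroup E]
    [InnerProductSpace ℝ E] [CompleteSpace E] {K : Set E} (hK : IsCompact K)
    (hconv : Convex ℝ K) {s : Finset E}
    (hs : (s : Set E) ⊆ K.extremePoints ℝ) :
    ∃ s' : Finset E, s'.card = s.card ∧ (s' : Set E) ⊆ K.exposedPoints ℝ := by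
  by_cases hfin : (K.exposedPoints ℝ).Finite
  · have hsub : K ⊆ convexHull ℝ (K.exposedPoints ℝ) := by
      intro x hx
      by_contra hnot
      obtain ⟨g, u, hu, hg⟩ := geometric_hahn_banach_point_closed (convex_convexHull ℝ _)
        (hfin.isCompact_convexHull ℝ).isClosed hnot
      obtain ⟨y, hy, hyu⟩ := hK.exists_mem_exposedPoints_lt hx g hu
      exact (hg y (subset_convexHull ℝ _ hy)).not_gt hyu
    have heq : convexHull ℝ (K.exposedPoints ℝ) = K :=
      (convexHull_min exposedPoints_subset hconv).antisymm hsub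
    refine ⟨s, rfl, hs.trans ?_⟩
    conv_lhs => rw [← heq]
    exact extremePoints_convexHull_subset
  · obtain ⟨s', hs', hcard⟩ := Set.Infinite.exists_subset_card_eq hfin s.card
    exact ⟨s', hcard, hs'⟩

/-- An exposed point of the closure of an open set `Ω` in a nontrivial space is not in `Ω`. -/
theorem notMem_of_mem_exposedPoints_closure {E : Type*} [NormedAddCommGroup E] [NormedSpace ℝ E]
    [Nontrivial E] {Ω : Set E} (hΩ : IsOpen Ω) {p : E} {g : E →L[ℝ] ℝ}
    (hg : ∀ x ∈ closure Ω, g x ≤ g p ∧ (g p ≤ g x → x = p)) : p ∉ Ω := by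
  intro hp
  obtain ⟨v, hv⟩ := exists_ne (0 : E)
  have hev : ∀ w : E, ∀ᶠ ε : ℝ in nhdsWithin 0 (Ioi 0), p + ε • w ∈ Ω := fun w => by
    have hc : Continuous fun ε : ℝ => p + ε • w := by fun_prop
    exact nhdsWithin_le_nhds (hc.continuousAt.preimage_mem_nhds
      (hΩ.mem_nhds (by simpa using hp)))
  obtain ⟨ε, ⟨h1, h2⟩, hε⟩ := (((hev v).and (hev (-v))).and self_mem_nhdsWithin).exists
  have hne : p + ε • v ≠ p := by simpa using ⟨(mem_Ioi.1 hε).ne', hv⟩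
  have k2 := (hg _ (subset_closure h2)).1
  refine hne ((hg _ (subset_closure h1)).2 ?_)
  simp only [map_add, map_smul, map_neg, smul_eq_mul] at k2 ⊢
  linarith

/-- Near an exposed point `p`, the sublevel sets of `logRatio` are small. -/
theorem exists_logRatio_lt_imp_mem {n : ℕ} {Ω : Set (Euc n)} (hΩ : IsConvexDomain Ω) {p : Euc n}
    {g₁ g₂ : Euc n →L[ℝ] ℝ} {α₂ : ℝ} (hg : ∀ x ∈ closure Ω, g₁ x ≤ g₁ p ∧ (g₁ p ≤ g₁ x → x = p))
    (h₂ : ∀ x ∈ Ω, g₂ x < α₂) {U : Set (Euc n)} (hU : IsOpen U) (hp : p ∈ U) :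
    ∃ L : ℝ, ∀ x ∈ Ω, logRatio g₁ g₂ (g₁ p) α₂ x < L → x ∈ U := by
  obtain ⟨⟨x₀, hx₀⟩, -, hbd, -⟩ := hΩ
  have hK : IsCompact (closure Ω) := hbd.isCompact_closure
  rcases (closure Ω \ U).eq_empty_or_nonempty with hem | hne
  · exact ⟨0, fun x hx _ => by
      by_contra hxU
      exact (hem ▸ (⟨subset_closure hx, hxU⟩ : x ∈ closure Ω \ U) : x ∈ (∅ : Set (Euc n)))⟩
  obtain ⟨y, hy, hymax⟩ := (hK.diff hU).exists_isMaxOn hne (f := g₁) g₁.continuous.continuousOn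
  obtain ⟨z, -, hzmin⟩ := hK.exists_isMinOn ⟨x₀, subset_closure hx₀⟩ (f := g₂)
    g₂.continuous.continuousOn
  have hδ : 0 < g₁ p - g₁ y := by
    by_contra! hle
    exact hy.2 ((hg y hy.1).2 (by linarith) ▸ hp)
  refine ⟨1 / 2 * Real.log ((g₁ p - g₁ y) / (α₂ - g₂ z)), fun x hx hlt => ?_⟩
  by_contra hxU
  have k1 : g₁ x ≤ g₁ y := hymax ⟨subset_closure hx, hxU⟩
  have k2 : g₂ z ≤ g₂ x := hzmin (subset_closure hx)
  have k3 := sub_pos.2 (h₂ x hx)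
  have k4 : 0 < α₂ - g₂ z := by linarith
  have : (g₁ p - g₁ y) / (α₂ - g₂ z) ≤ (g₁ p - g₁ x) / (α₂ - g₂ x) := by
    gcongr
    linarith
  have := Real.log_le_log (by positivity) this
  rw [logRatio] at hlt
  linarith

/-- Balls of large radius have a large part in any neighborhood of an exposed point. -/
theorem IsHilbertModel.exists_le_hausdorffMeasure_of_mem_exposedPoints {m : ℕ}
    {Ω : Set (Euc (m + 1))} {d : Euc (m + 1) → Euc (m + 1) → ℝ} {X : Type*} [MetricSpace X]
    [MeasurableSpace X] [BorelSpace X] {φ : X → Euc (m + 1)} (h : IsHilbertModel Ω d φ) {c : ℝ}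
    (hc : 0 ≤ c)
    (hm : ∀ (x : X) (W : Submodule ℝ (Euc (m + 1))), Module.finrank ℝ W = m → ∀ R : ℝ, 0 < R →
      ENNReal.ofReal (c * R ^ m) ≤ μH[(m : ℝ)] {y | φ y - φ x ∈ W ∧ dist x y < R})
    (o : X) {p : Euc (m + 1)} (hp : p ∈ (closure Ω).exposedPoints ℝ) {U : Set (Euc (m + 1))}
    (hU : IsOpen U) (hpU : p ∈ U) :
    ∃ T : ℝ, 0 ≤ T ∧ ∀ R, T < R → ∃ S : Set X, MeasurableSet S ∧ S ⊆ Metric.ball o R ∧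
      S ⊆ φ ⁻¹' U ∧
      ENNReal.ofReal (c * ((R - T) / 2) ^ (m + 1)) ≤ μH[((m + 1 : ℕ) : ℝ)] S := by
  obtain ⟨-, hop, hbd, hconv⟩ := h.convexDomain
  obtain ⟨hpK, g₁, hg⟩ := hp
  have hpΩ : p ∉ Ω := notMem_of_mem_exposedPoints_closure hop hg
  set v := φ o - p with hv
  have hv0 : v ≠ 0 := sub_ne_zero.2 fun he => hpΩ (he ▸ h.mem o)
  have hpv : φ o + (-1 : ℝ) • v = p := by rw [hv]; module
  have ha : φ o + (-1 : ℝ) • v ∈ frontier Ω := by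
    rw [hpv, hop.frontier_eq]
    exact ⟨hpK, hpΩ⟩
  have h₁ : ∀ x ∈ Ω, g₁ x < g₁ (φ o + (-1 : ℝ) • v) := fun x hx => by
    rw [hpv]
    by_contra! hle
    exact hpΩ ((hg x (subset_closure hx)).2 hle ▸ hx)
  obtain ⟨t, ht, hb⟩ := exists_add_smul_mem_frontier hop hbd (h.mem o) hv0
  obtain ⟨g₂, h₂⟩ := geometric_hahn_banach_open_point hconv hop
    (hop.frontier_eq ▸ hb : φ o + t • v ∈ closure Ω \ Ω).2
  obtain ⟨L, hL⟩ := exists_logRatio_lt_imp_mem h.convexDomain hg h₂ hU hpU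
  set T := max 0 (logRatio g₁ g₂ (g₁ p) (g₂ (φ o + t • v)) (φ o) - L) with hT
  refine ⟨T, le_max_left _ _, fun R hR => ⟨_, ?_, ?_, ?_,
    h.le_hausdorffMeasure_cap hc hm o (W := ⊤) (by simp) Submodule.mem_top (by norm_num) ht ha hb
      h₁ h₂ (le_max_left _ _) hR⟩⟩
  · have hf := (h.lipschitzWith_logRatio h₁ h₂).continuous
    simp only [Submodule.mem_top, true_and]
    exact ((isOpen_lt (continuous_const.dist continuous_id) continuous_const).inter
      (isOpen_lt hf continuous_const)).measurableSet
  · rintro y ⟨-, hy, -⟩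
    rwa [Metric.mem_ball, dist_comm]
  · rintro y ⟨-, -, hy⟩
    rw [hpv] at hy
    refine hL _ (h.mem y) (hy.trans_le ?_)
    have := le_max_right 0 (logRatio g₁ g₂ (g₁ p) (g₂ (φ o + t • v)) (φ o) - L)
    linarith

/-- If the closure of `Ω` has `k` exposed points, the volume of balls of radius `R` is eventually at
least `k * c * (R / 4) ^ n`. -/
theorem IsHilbertModel.eventually_le_hausdorffMeasure_ball {m : ℕ}
    {Ω : Set (Euc (m + 1))} {d : Euc (m + 1) → Euc (m + 1) → ℝ} {X : Type*} [MetricSpace X]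
    [MeasurableSpace X] [BorelSpace X] {φ : X → Euc (m + 1)} (h : IsHilbertModel Ω d φ) {c : ℝ}
    (hc : 0 ≤ c)
    (hm : ∀ (x : X) (W : Submodule ℝ (Euc (m + 1))), Module.finrank ℝ W = m → ∀ R : ℝ, 0 < R →
      ENNReal.ofReal (c * R ^ m) ≤ μH[(m : ℝ)] {y | φ y - φ x ∈ W ∧ dist x y < R})
    (o : X) {s : Finset (Euc (m + 1))}
    (hs : (s : Set (Euc (m + 1))) ⊆ (closure Ω).exposedPoints ℝ) :
    ∀ᶠ R : ℝ in atTop, ENNReal.ofReal (s.card * (c * (R / 4) ^ (m + 1))) ≤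
      μH[((m + 1 : ℕ) : ℝ)] (Metric.ball o R) := by
  obtain ⟨U, hU, hdisj⟩ := s.finite_toSet.t2_separation
  have hex := fun p : s => h.exists_le_hausdorffMeasure_of_mem_exposedPoints hc hm o (hs p.2)
    (hU p).2 (hU p).1
  choose T hT hTR using hex
  have hev : ∀ᶠ R : ℝ in atTop, ∀ p : s, 2 * T p < R :=
    eventually_all.2 fun p => eventually_gt_atTop _
  filter_upwards [hev, eventually_gt_atTop 0] with R hR hR0
  have hTlt : ∀ p, T p < R := fun p => by linarith [hR p, hT p]
  choose S hSm hSb hSU hSμ using fun p => hTR p R (hTlt p)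
  have hSdisj : Pairwise (Function.onFun Disjoint S) := fun p q hpq =>
    ((hdisj p.2 q.2 (Subtype.coe_injective.ne hpq)).preimage φ).mono (hSU p) (hSU q)
  calc ENNReal.ofReal (s.card * (c * (R / 4) ^ (m + 1)))
      = ∑ _p : s, ENNReal.ofReal (c * (R / 4) ^ (m + 1)) := by
        rw [ENNReal.ofReal_mul (by positivity)]
        simp
    _ ≤ ∑ p : s, μH[((m + 1 : ℕ) : ℝ)] (S p) := by
        refine Finset.sum_le_sum fun p _ => le_trans ?_ (hSμ p)
        have : R / 4 ≤ (R - T p) / 2 := by linarith [hR p]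
        gcongr
    _ = μH[((m + 1 : ℕ) : ℝ)] (⋃ p, S p) := by
        rw [measure_iUnion hSdisj hSm, tsum_fintype]
    _ ≤ μH[((m + 1 : ℕ) : ℝ)] (Metric.ball o R) := measure_mono (iUnion_subset hSb)

/-- **Lower bound on the asymptotic volume (Vernicos).**  For each `n` there is a constant
`aₙ > 0` such that for every Hilbert geometry `(Ω, d_Ω)` of dimension `n` (realized as an
abstract metric space `X` identified with `(Ω, d_Ω)` via `φ`) whose closure admits at least
`k` extremal points, and every `o ∈ Ω`, one has
`aₙ · k ≤ limsup_{R→∞} Vol(B_Ω(o,R))/Rⁿ`, where `Vol` is the `n`-dimensional Hausdorff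
measure of the metric space `(Ω, d_Ω)`. -/
theorem asymptotic_volume_lower_bound (n : ℕ) :
    ∃ a : ℝ, 0 < a ∧
      ∀ (Ω : Set (Euc n)) (d : Euc n → Euc n → ℝ),
        IsConvexDomain Ω → IsHilbertDist Ω d →
        ∀ (X : Type) [MetricSpace X] [MeasurableSpace X] [BorelSpace X]
          (φ : X → Euc n), Set.BijOn φ Set.univ Ω →
          (∀ p q : X, dist p q = d (φ p) (φ q)) →
          ∀ k : ℕ,
            (∃ s : Finset (Euc n), s.card = k ∧
              (↑s : Set (Euc n)) ⊆ Set.extremePoints ℝ (closure Ω)) →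
            ∀ o : X,
              ENNReal.ofReal (a * k) ≤
                Filter.limsup
                  (fun R : ℝ => μH[(n : ℝ)] (Metric.ball o R) / ENNReal.ofReal (R ^ n))
                  Filter.atTop := by
  rcases n with _ | m
  · refine ⟨1, one_pos, ?_⟩
    rintro Ω d - - X _ _ _ φ - - k ⟨s, hs, -⟩ o
    refine le_limsup_of_frequently_le' (Eventually.frequently ?_)
    filter_upwards [eventually_gt_atTop 0] with R hR
    have hk : (k : ℝ) ≤ 1 := by
      rw [← hs]
      exact_mod_cast Finset.card_le_one_of_subsingleton s
    have h1 := Measure.one_le_hausdorffMeasure_zero_of_nonempty (Metric.nonempty_ball (x := o).2 hR)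
    have h2 : ENNReal.ofReal (1 * k) ≤ 1 := by simpa using hk
    simpa using h2.trans h1
  obtain ⟨c, hc, hm⟩ := exists_le_hausdorffMeasure_section_ball m
  refine ⟨c / 4 ^ (m + 1), by positivity, ?_⟩
  rintro Ω d hΩ hd X _ _ _ φ hφ hdist k ⟨s, hcard, hs⟩ o
  have h : IsHilbertModel Ω d φ :=
    ⟨hΩ, hd, fun x => hφ.mapsTo (mem_univ x), fun p hp => (hφ.surjOn hp).imp fun _ hx => hx.2, hdist⟩
  obtain ⟨s', hcard', hs'⟩ := exists_finset_subset_exposedPoints hΩ.2.2.1.isCompact_closure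
    hΩ.2.2.2.closure hs
  refine le_limsup_of_frequently_le' (Eventually.frequently ?_)
  filter_upwards [h.eventually_le_hausdorffMeasure_ball hc.le (hm _ Ω d X φ h) o hs',
    eventually_gt_atTop 0] with R hR hR0
  have hRn : 0 < R ^ (m + 1) := by positivity
  rw [ENNReal.le_div_iff_mul_le (Or.inl (ENNReal.ofReal_pos.2 hRn).ne')
    (Or.inl ENNReal.ofReal_ne_top), ← ENNReal.ofReal_mul (by positivity)]
  refine le_trans (le_of_eq ?_) hR
  rw [hcard', hcard, div_pow]
  congr 1
  ring
end
end

section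
/- For each n there exists a constant bₙ > 0 such that for every Hilbert geometry (Ω, d_Ω) of dimension n, every point o ∈ Ω, and every R ≥ 1, the n-dimensional Hausdorff measure (with respect to d_Ω) of the metric ball B_Ω(o,R) satisfies Vol(B_Ω(o,R)) ≥ bₙ · Rⁿ. -/
open Set Filter MeasureTheory

noncomputable section

/-- **Eilenberg's inequality** for `1`-Lipschitz functions. -/
theorem lintegral_hausdorffMeasure_fiber_le {X : Type*} [MetricSpace X] [MeasurableSpace X]
    [BorelSpace X] {f : X → ℝ} (hf : LipschitzWith 1 f) (d : ℕ) (A : Set X) :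
    ∫⁻ t, μH[(d : ℝ)] (A ∩ f ⁻¹' {t}) ≤ μH[((d + 1 : ℕ) : ℝ)] A := by
  rcases eq_or_ne (μH[((d + 1 : ℕ) : ℝ)] A) ⊤ with htop | htop
  · rw [htop]; exact le_top
  have hcover : ∀ k : ℕ, ∃ E : ℕ → Set X, A ⊆ ⋃ i, E i ∧
      (∀ i, Metric.ediam (E i) ≤ ((k : ENNReal) + 1)⁻¹) ∧
      ∑' i, (⨆ _ : (E i).Nonempty, Metric.ediam (E i) ^ ((d + 1 : ℕ) : ℝ)) ≤
        μH[((d + 1 : ℕ) : ℝ)] A + ((k : ENNReal) + 1)⁻¹ := by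
    intro k
    have hpos : (0 : ENNReal) < ((k : ENNReal) + 1)⁻¹ := by
      rw [ENNReal.inv_pos]; finiteness
    have hlt : μH[((d + 1 : ℕ) : ℝ)] A < μH[((d + 1 : ℕ) : ℝ)] A + ((k : ENNReal) + 1)⁻¹ :=
      ENNReal.lt_add_right htop hpos.ne'
    have hle := Measure.hausdorffMeasure_apply ((d + 1 : ℕ) : ℝ) A
    have := (le_iSup₂ (f := fun (r : ENNReal) (_ : 0 < r) =>
        ⨅ (t : ℕ → Set X) (_ : A ⊆ ⋃ n, t n) (_ : ∀ n, Metric.ediam (t n) ≤ r),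
          ∑' n, ⨆ _ : (t n).Nonempty, Metric.ediam (t n) ^ ((d + 1 : ℕ) : ℝ)) _ hpos)
    rw [← hle] at this
    have := this.trans_lt hlt
    simp only [iInf_lt_iff] at this
    obtain ⟨E, h1, h2, h3⟩ := this
    exact ⟨E, h1, h2, h3.le⟩
  choose E hE1 hE2 hE3 using hcover
  have hlim : Tendsto (fun k : ℕ => ((k : ENNReal) + 1)⁻¹) atTop (nhds 0) := by
    have := (tendsto_add_atTop_iff_nat 1).2 ENNReal.tendsto_inv_nat_nhds_zero
    simpa using this
  let g : ℕ → ℝ → ENNReal := fun k t =>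
    ∑' i, (closure (f '' E k i)).indicator (fun _ => Metric.ediam (E k i) ^ (d : ℝ)) t
  have hgm : ∀ k i, Measurable
      ((closure (f '' E k i)).indicator (fun _ => Metric.ediam (E k i) ^ (d : ℝ))) := fun k i =>
    measurable_const.indicator isClosed_closure.measurableSet
  have hfiber : ∀ t, μH[(d : ℝ)] (A ∩ f ⁻¹' {t}) ≤ liminf (fun k => g k t) atTop := by
    intro t
    refine (Measure.hausdorffMeasure_le_liminf_tsum
      (ι := fun k => {i : ℕ // (E k i ∩ f ⁻¹' {t}).Nonempty}) (d : ℝ) _ _ hlim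
      (fun k i => E k i ∩ f ⁻¹' {t})
      (Eventually.of_forall fun k i => (Metric.ediam_mono inter_subset_left).trans (hE2 k i))
      (Eventually.of_forall fun k => ?_)).trans
      (liminf_le_liminf (Eventually.of_forall fun k => ?_))
    · rintro x ⟨hxA, hxt⟩
      obtain ⟨i, hi⟩ := mem_iUnion.1 (hE1 k hxA)
      exact mem_iUnion.2 ⟨⟨i, x, hi, hxt⟩, hi, hxt⟩
    · refine le_trans (ENNReal.tsum_le_tsum fun i => ?_)
        (ENNReal.tsum_comp_le_tsum_of_injective (Subtype.val_injective) _)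
      obtain ⟨i, x, hx, rfl⟩ := i
      simp only
      rw [indicator_of_mem (subset_closure (mem_image_of_mem f hx))]
      exact ENNReal.rpow_le_rpow (Metric.ediam_mono inter_subset_left) (Nat.cast_nonneg d)
  have hint : ∀ k, ∫⁻ t, g k t ≤ μH[((d + 1 : ℕ) : ℝ)] A + ((k : ENNReal) + 1)⁻¹ := by
    intro k
    rw [lintegral_tsum fun i => (hgm k i).aemeasurable]
    refine (ENNReal.tsum_le_tsum fun i => ?_).trans (hE3 k)
    rw [lintegral_indicator_const isClosed_closure.measurableSet]
    rcases (E k i).eq_empty_or_nonempty with hem | hne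
    · simp [hem]
    · rw [iSup_pos hne, Nat.cast_add_one,
        ENNReal.rpow_add_of_nonneg _ _ (Nat.cast_nonneg d) zero_le_one, ENNReal.rpow_one]
      gcongr
      calc volume (closure (f '' E k i)) ≤ Metric.ediam (closure (f '' E k i)) :=
            Real.volume_le_diam _
        _ ≤ Metric.ediam (E k i) := by
            rw [Metric.ediam_closure]
            simpa using hf.ediam_image_le (E k i)
  calc ∫⁻ t, μH[(d : ℝ)] (A ∩ f ⁻¹' {t}) ≤ ∫⁻ t, liminf (fun k => g k t) atTop :=
        lintegral_mono hfiber
    _ ≤ liminf (fun k => ∫⁻ t, g k t) atTop :=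
        lintegral_liminf_le fun k => Measurable.tsum (hgm k)
    _ ≤ liminf (fun k : ℕ => μH[((d + 1 : ℕ) : ℝ)] A + ((k : ENNReal) + 1)⁻¹) atTop :=
        liminf_le_liminf (Eventually.of_forall hint)
    _ = μH[((d + 1 : ℕ) : ℝ)] A := by
        refine Tendsto.liminf_eq ?_
        simpa using tendsto_const_nhds.add hlim

theorem exists_pos_add_smul_mem_frontier_s6 {E : Type*} [NormedAddCommGroup E] [NormedSpace ℝ E]
    {U : Set E} (hU : IsOpen U) (hb : Bornology.IsBounded U) {p v : E} (hp : p ∈ U) (hv : v ≠ 0) :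
    ∃ t : ℝ, 0 < t ∧ p + t • v ∈ frontier U := by
  have hc : Continuous fun t : ℝ => p + t • v := by fun_prop
  obtain ⟨C, hC⟩ := hb.exists_norm_le
  have hv' : 0 < ‖v‖ := norm_pos_iff.2 hv
  have hpC := hC p hp
  have hout : p + ((2 * C + 1) / ‖v‖) • v ∉ U := by
    intro h
    have h1 := hC _ h
    have h2 : ‖((2 * C + 1) / ‖v‖) • v‖ ≤ 2 * C := by
      calc ‖((2 * C + 1) / ‖v‖) • v‖ = ‖(p + ((2 * C + 1) / ‖v‖) • v) - p‖ := by
            rw [add_sub_cancel_left]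
        _ ≤ _ := (norm_sub_le _ _).trans (by linarith)
    rw [norm_smul, Real.norm_eq_abs, abs_div, abs_norm, div_mul_cancel₀ _ hv'.ne'] at h2
    linarith [le_abs_self (2 * C + 1)]
  have hpre : IsPreconnected ((fun t : ℝ => p + t • v) '' Ici 0) :=
    isPreconnected_Ici.image _ hc.continuousOn
  have hC0 : 0 ≤ C := (norm_nonneg p).trans hpC
  obtain ⟨t, ht, htf⟩ : ∃ t : ℝ, 0 ≤ t ∧ p + t • v ∈ frontier U := by
    by_contra! hno
    obtain ⟨_, ⟨t, ht, rfl⟩, hmem, hnot⟩ := hpre U (closure U)ᶜ hU isClosed_closure.isOpen_compl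
      (by
        rintro _ ⟨t, ht, rfl⟩
        by_cases hmem : p + t • v ∈ U
        · exact Or.inl hmem
        · exact Or.inr fun hcl => hno t ht (by rw [hU.frontier_eq]; exact ⟨hcl, hmem⟩))
      ⟨p, ⟨0, self_mem_Ici, by simp⟩, hp⟩
      ⟨_, ⟨(2 * C + 1) / ‖v‖, mem_Ici.2 (by positivity), rfl⟩, fun hcl =>
        hno ((2 * C + 1) / ‖v‖) (by positivity) (by rw [hU.frontier_eq]; exact ⟨hcl, hout⟩)⟩
    exact hnot (subset_closure hmem)
  refine ⟨t, lt_of_le_of_ne ht ?_, htf⟩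
  rintro rfl
  rw [hU.frontier_eq] at htf
  exact htf.2 (by simpa using hp)

/-- `φ` identifies the metric space `X` with a Hilbert geometry on a bounded convex open subset
of `E`. -/
structure IsHilbertChart {X E : Type*} [MetricSpace X] [NormedAddCommGroup E] [NormedSpace ℝ E]
    (φ : X → E) : Prop where
  injective : Function.Injective φ
  isOpen_range : IsOpen (range φ)
  isBounded_range : Bornology.IsBounded (range φ)
  convex_range : Convex ℝ (range φ)
  dist_eq : ∀ p q : X, p ≠ q → ∀ s t : ℝ, s < 0 → 1 < t →
    φ p + s • (φ q - φ p) ∈ frontier (range φ) → φ p + t • (φ q - φ p) ∈ frontier (range φ) →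
    dist p q = (1 / 2) * Real.log ((1 - s) / (-s) * (t / (t - 1)))

namespace IsHilbertChart

variable {X E : Type*} [MetricSpace X] [NormedAddCommGroup E] [NormedSpace ℝ E] {φ : X → E}

/-- Sections of a Hilbert geometry by affine subspaces are Hilbert geometries. -/
theorem section_chart (h : IsHilbertChart φ) (o : X) (K : Submodule ℝ E) :
    IsHilbertChart
      (fun y : {x : X // φ x - φ o ∈ K} => (⟨φ y - φ o, y.2⟩ : K)) := by
  set ψ := fun y : {x : X // φ x - φ o ∈ K} => (⟨φ y - φ o, y.2⟩ : K) with hψ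
  have hrange : range ψ = (fun k : K => φ o + (k : E)) ⁻¹' range φ := by
    ext k
    constructor
    · rintro ⟨y, rfl⟩
      exact ⟨y, by simp [hψ]⟩
    · rintro ⟨x, hx⟩
      have hx' : φ x - φ o = k := by rw [hx]; simp
      exact ⟨⟨x, by rw [hx']; exact k.2⟩, Subtype.ext hx'⟩
  have hc : Continuous fun k : K => φ o + (k : E) := by fun_prop
  have hopen : IsOpen (range ψ) := by rw [hrange]; exact h.isOpen_range.preimage hc
  have hfr : ∀ k : K, k ∈ frontier (range ψ) → φ o + (k : E) ∈ frontier (range φ) := by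
    intro k hk
    rw [hrange] at hk
    exact hc.frontier_preimage_subset _ hk
  refine ⟨?_, hopen, ?_, ?_, ?_⟩
  · intro y z hyz
    exact Subtype.ext (h.injective (sub_left_injective (congrArg Subtype.val hyz)))
  · obtain ⟨C, hC⟩ := h.isBounded_range.exists_norm_le
    refine isBounded_iff_forall_norm_le.2 ⟨C + C, ?_⟩
    rintro _ ⟨y, rfl⟩
    exact (norm_sub_le _ _).trans (add_le_add (hC _ ⟨_, rfl⟩) (hC _ ⟨_, rfl⟩))
  · rw [hrange]
    intro k hk l hl a b ha hb hab
    have := h.convex_range hk hl ha hb hab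
    simp only [mem_preimage, Submodule.coe_add, Submodule.coe_smul]
    convert! this using 1
    rw [smul_add, smul_add, add_add_add_comm, ← add_smul, hab, one_smul]
  · intro p q hpq s t hs ht ha hb
    have key : ∀ r : ℝ, φ o + ((ψ p + r • (ψ q - ψ p) : K) : E) =
        φ p + r • (φ q - φ p) := by
      intro r
      simp [hψ, ← add_assoc]
    refine h.dist_eq p q (fun hh => hpq (Subtype.ext hh)) s t hs ht ?_ ?_
    · rw [← key]; exact hfr _ ha
    · rw [← key]; exact hfr _ hb

/-- Logarithms of quotients of positive affine functions are Lipschitz for the Hilbert distance. -/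
theorem log_sub_log_le (h : IsHilbertChart φ) (f g : E →L[ℝ] ℝ) (c d : ℝ)
    (hf : ∀ x, 0 < c - f (φ x)) (hg : ∀ x, 0 < d - g (φ x)) (p q : X) :
    (1 / 2) * (Real.log (c - f (φ q)) - Real.log (d - g (φ q))) -
      (1 / 2) * (Real.log (c - f (φ p)) - Real.log (d - g (φ p))) ≤ dist p q := by
  rcases eq_or_ne p q with rfl | hpq
  · simp
  have hne : φ q - φ p ≠ 0 := sub_ne_zero.2 fun hh => hpq (h.injective hh.symm)
  obtain ⟨s, hs, hsf⟩ := exists_pos_add_smul_mem_frontier_s6 h.isOpen_range h.isBounded_range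
    ⟨p, rfl⟩ (neg_ne_zero.2 hne)
  obtain ⟨t, ht, htf⟩ := exists_pos_add_smul_mem_frontier_s6 h.isOpen_range h.isBounded_range
    ⟨q, rfl⟩ hne
  have e1 : φ p + s • -(φ q - φ p) = φ p + (-s) • (φ q - φ p) := by module
  have e2 : φ q + t • (φ q - φ p) = φ p + (1 + t) • (φ q - φ p) := by module
  rw [e1] at hsf
  rw [e2] at htf
  rw [h.dist_eq p q hpq (-s) (1 + t) (by linarith) (by linarith) hsf htf]
  have hnonneg : ∀ (k : E →L[ℝ] ℝ) (e : ℝ), (∀ x, 0 < e - k (φ x)) →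
      ∀ y ∈ frontier (range φ), 0 ≤ e - k y := by
    intro k e hk y hy
    have hcl : IsClosed {y | 0 ≤ e - k y} :=
      isClosed_le continuous_const (by fun_prop)
    refine closure_minimal ?_ hcl (frontier_subset_closure hy)
    rintro _ ⟨x, rfl⟩
    exact (hk x).le
  have f1 := hnonneg f c hf _ hsf
  have g1 := hnonneg g d hg _ htf
  have hfp := hf p
  have hfq := hf q
  have hgp := hg p
  have hgq := hg q
  simp only [map_add, map_smul, map_sub, smul_eq_mul] at f1 g1
  rw [← mul_sub]
  refine mul_le_mul_of_nonneg_left ?_ (by norm_num)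
  have hA : (c - f (φ q)) / (c - f (φ p)) ≤ (1 + s) / s := by
    rw [div_le_div_iff₀ hfp hs]; nlinarith
  have hB : (d - g (φ p)) / (d - g (φ q)) ≤ (1 + t) / t := by
    rw [div_le_div_iff₀ hgq ht]; nlinarith
  have hA' := Real.log_le_log (by positivity) hA
  have hB' := Real.log_le_log (by positivity) hB
  rw [Real.log_div hfq.ne' hfp.ne'] at hA'
  rw [Real.log_div hgp.ne' hgq.ne'] at hB'
  rw [show (1 - -s) / (- -s) * ((1 + t) / (1 + t - 1)) = (1 + s) / s * ((1 + t) / t) by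
    simp, Real.log_mul (by positivity) (by positivity)]
  linarith

theorem add_smul_mem_range (h : IsHilbertChart φ) (o : X) {v : E} {r t : ℝ} (hr : 0 ≤ r)
    (hrt : r < t) (ht : φ o + t • v ∈ frontier (range φ)) : φ o + r • v ∈ range φ := by
  have ht0 : 0 < t := hr.trans_lt hrt
  have hmem := h.convex_range.add_smul_sub_mem_interior' (frontier_subset_closure ht)
    (h.isOpen_range.interior_eq.symm ▸ mem_range_self o) (t := 1 - r / t)
    ⟨by rw [sub_pos, div_lt_one ht0]; exact hrt, by linarith [div_nonneg hr ht0.le]⟩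
  rw [h.isOpen_range.interior_eq] at hmem
  convert! hmem using 1
  have : r • v = (r / t) • t • v := by rw [smul_smul, div_mul_cancel₀ _ ht0.ne']
  rw [this]
  module

/-- Every point lies on a line along which a `1`-Lipschitz function restricts to an arclength
parametrization and whose transversal hyperplane sections lie in the fibres of that function. -/
theorem exists_lipschitz_fibration [Nontrivial E] [FiniteDimensional ℝ E] (h : IsHilbertChart φ)
    (o : X) : ∃ F : X → ℝ, LipschitzWith 1 F ∧ ∀ τ : ℝ, ∃ o' : X, dist o o' ≤ |τ| ∧
      ∃ K : Submodule ℝ E, Module.finrank ℝ K + 1 = Module.finrank ℝ E ∧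
        ∀ x, φ x - φ o' ∈ K → F x = F o + τ := by
  obtain ⟨v, hv⟩ := exists_ne (0 : E)
  obtain ⟨s, hs, hsf⟩ := exists_pos_add_smul_mem_frontier_s6 h.isOpen_range h.isBounded_range
    ⟨o, rfl⟩ (neg_ne_zero.2 hv)
  obtain ⟨t, ht, htf⟩ := exists_pos_add_smul_mem_frontier_s6 h.isOpen_range h.isBounded_range
    ⟨o, rfl⟩ hv
  have hnot : ∀ y ∈ frontier (range φ), y ∉ range φ := fun y hy => by
    rw [h.isOpen_range.frontier_eq] at hy; exact hy.2
  obtain ⟨f, hf⟩ := geometric_hahn_banach_open_point h.convex_range h.isOpen_range (hnot _ hsf)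
  obtain ⟨g, hg⟩ := geometric_hahn_banach_open_point h.convex_range h.isOpen_range (hnot _ htf)
  set c := f (φ o + s • -v) with hc
  set d := g (φ o + t • v) with hd
  have hf' : ∀ x, 0 < c - f (φ x) := fun x => sub_pos.2 (hf _ ⟨x, rfl⟩)
  have hg' : ∀ x, 0 < d - g (φ x) := fun x => sub_pos.2 (hg _ ⟨x, rfl⟩)
  simp only [map_add, map_smul, map_neg, smul_eq_mul] at hc hd
  have hfv : 0 < -f v := by
    have := hf' o
    rw [hc] at this
    exact (mul_pos_iff_of_pos_left hs).1 (by linarith)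
  have hgv : 0 < g v := by
    have := hg' o
    rw [hd] at this
    exact (mul_pos_iff_of_pos_left ht).1 (by linarith)
  have hlip := h.log_sub_log_le f g c d hf' hg'
  refine ⟨fun x => (1 / 2) * (Real.log (c - f (φ x)) - Real.log (d - g (φ x))), ?_, ?_⟩
  · refine LipschitzWith.of_le_add fun x y => ?_
    have := hlip y x
    rw [dist_comm] at this
    linarith
  intro τ
  set l := Real.exp (2 * τ) * s / t with hl
  have hl0 : 0 < l := by positivity
  have hlog : Real.log (l * t / s) = 2 * τ := by
    rw [hl, div_mul_cancel₀ _ ht.ne', mul_div_cancel_right₀ _ hs.ne', Real.log_exp]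
  set r := (l * t - s) / (1 + l) with hr
  have hsr : s + r = l * (t - r) := by rw [hr]; field_simp; ring
  have htr : t - r = (t + s) / (1 + l) := by rw [hr]; field_simp; ring
  have htr0 : 0 < t - r := by rw [htr]; positivity
  have hsr0 : 0 < s + r := by rw [hsr]; positivity
  have hquot : (s + r) / s * (t / (t - r)) = l * t / s := by
    rw [hsr]; field_simp
  obtain ⟨o', ho'⟩ : φ o + r • v ∈ range φ := by
    rcases le_total 0 r with h0 | h0
    · exact h.add_smul_mem_range o h0 (by linarith) htf
    · have := h.add_smul_mem_range o (v := -v) (r := -r) (by linarith) (by linarith) hsf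
      simpa using this
  have hfo : c - f (φ o) = -f v * s := by rw [hc]; ring
  have hgo : d - g (φ o) = g v * t := by rw [hd]; ring
  have hfo' : c - f (φ o') = -f v * (s + r) := by
    rw [ho', hc, map_add, map_smul, smul_eq_mul]; ring
  have hgo' : d - g (φ o') = g v * (t - r) := by
    rw [ho', hd, map_add, map_smul, smul_eq_mul]; ring
  refine ⟨o', ?_, ?_⟩
  · rcases eq_or_ne o o' with rfl | hne
    · simp
    have hr0 : r ≠ 0 := by
      intro h0
      rw [h0, zero_smul, add_zero] at ho'
      exact hne (h.injective ho'.symm)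
    have hdiff : φ o' - φ o = r • v := by rw [ho', add_sub_cancel_left]
    have e1 : φ o + (-s / r) • (φ o' - φ o) = φ o + s • -v := by
      rw [hdiff, smul_smul, div_mul_cancel₀ _ hr0, neg_smul, smul_neg]
    have e2 : φ o + (t / r) • (φ o' - φ o) = φ o + t • v := by
      rw [hdiff, smul_smul, div_mul_cancel₀ _ hr0]
    rcases lt_or_gt_of_ne hr0 with hneg | hpos
    · rw [h.dist_eq o o' hne (t / r) (-s / r) (div_neg_of_pos_of_neg ht hneg)
        (by rw [lt_div_iff_of_neg hneg]; linarith) (e2 ▸ htf) (e1 ▸ hsf)]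
      have : (1 - t / r) / -(t / r) * (-s / r / (-s / r - 1)) = (l * t / s)⁻¹ := by
        rw [← hquot]
        have h1 : -s / r - 1 = -(s + r) / r := by field_simp; ring
        have h2 : 1 - t / r = -(t - r) / r := by field_simp; ring
        rw [h1, h2]
        field_simp
      rw [this, Real.log_inv, hlog]
      linarith [neg_le_abs τ]
    · rw [h.dist_eq o o' hne (-s / r) (t / r) (div_neg_of_neg_of_pos (by linarith) hpos)
        (by rw [lt_div_iff₀ hpos]; linarith) (e1 ▸ hsf) (e2 ▸ htf)]
      have : (1 - -s / r) / -(-s / r) * (t / r / (t / r - 1)) = l * t / s := by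
        rw [← hquot]
        have h1 : 1 - -s / r = (s + r) / r := by field_simp; ring
        have h2 : t / r - 1 = (t - r) / r := by field_simp
        rw [h1, h2]
        field_simp
      rw [this, hlog]
      linarith [le_abs_self τ]
  · set e := (c - f (φ o')) / (d - g (φ o')) with he
    have he0 : 0 < e := div_pos (hf' o') (hg' o')
    have hne : ((f - e • g : E →L[ℝ] ℝ) : E →ₗ[ℝ] ℝ) ≠ 0 := by
      intro h0
      have := LinearMap.congr_fun h0 v
      simp at this
      nlinarith [mul_pos he0 hgv]
    refine ⟨LinearMap.ker ((f - e • g : E →L[ℝ] ℝ) : E →ₗ[ℝ] ℝ),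
      Module.Dual.finrank_ker_add_one_of_ne_zero hne, fun x hx => ?_⟩
    simp [sub_eq_zero] at hx
    have hfx : c - f (φ x) = e * (d - g (φ x)) := by
      have : c - f (φ o') = e * (d - g (φ o')) := by
        rw [he, div_mul_cancel₀ _ (hg' o').ne']
      linarith
    have h1 : Real.log (c - f (φ x)) = Real.log e + Real.log (d - g (φ x)) := by
      rw [hfx, Real.log_mul he0.ne' (hg' x).ne']
    have h2 : Real.log e = Real.log (-f v) + Real.log (s + r) -
        (Real.log (g v) + Real.log (t - r)) := by
      rw [he, Real.log_div (hf' o').ne' (hg' o').ne', hfo', hgo',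
        Real.log_mul hfv.ne' hsr0.ne', Real.log_mul hgv.ne' htr0.ne']
    rw [← hquot, Real.log_mul (by positivity) (by positivity), Real.log_div hsr0.ne' hs.ne',
      Real.log_div ht.ne' htr0.ne'] at hlog
    simp only [hfo, hgo, h1, h2, Real.log_mul hfv.ne' hs.ne', Real.log_mul hgv.ne' ht.ne']
    linarith

end IsHilbertChart

theorem IsHilbertChart.exists_le_hausdorffMeasure_ball (n : ℕ) : ∃ b : ℝ, 0 < b ∧
    ∀ (E : Type) [NormedAddCommGroup E] [NormedSpace ℝ E] [FiniteDimensional ℝ E],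
      Module.finrank ℝ E = n → ∀ (X : Type) [MetricSpace X] [MeasurableSpace X] [BorelSpace X]
        (φ : X → E), IsHilbertChart φ → ∀ (o : X) (R : ℝ), 0 < R →
          ENNReal.ofReal (b * R ^ n) ≤ μH[(n : ℝ)] (Metric.ball o R) := by
  induction n with
  | zero =>
    refine ⟨1, one_pos, ?_⟩
    intro E _ _ _ _ X _ _ _ φ _ o R hR
    simpa using Measure.one_le_hausdorffMeasure_zero_of_nonempty ⟨o, Metric.mem_ball_self hR⟩
  | succ n ih =>
    obtain ⟨b, hb, ih⟩ := ih
    refine ⟨b / 2 ^ n, by positivity, ?_⟩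
    intro E _ _ _ hE X _ _ _ φ h o R hR
    have : Nontrivial E := Module.nontrivial_of_finrank_pos (R := ℝ) (by omega)
    obtain ⟨F, hF, hfib⟩ := h.exists_lipschitz_fibration o
    have hfiber : ∀ u ∈ Ioo (F o - R / 2) (F o + R / 2), ENNReal.ofReal (b * (R / 2) ^ n) ≤
        μH[(n : ℝ)] (Metric.ball o R ∩ F ⁻¹' {u}) := by
      intro u hu
      obtain ⟨o', ho', K, hK, hKF⟩ := hfib (u - F o)
      have hdist : dist o o' < R / 2 :=
        ho'.trans_lt (abs_lt.2 ⟨by linarith [hu.1], by linarith [hu.2]⟩)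
      have hsec := ih K (by omega) {x : X // φ x - φ o' ∈ K} _ (h.section_chart o' K)
        ⟨o', by simp⟩ (R / 2) (by positivity)
      rw [← isometry_subtype_coe.hausdorffMeasure_image (Or.inl n.cast_nonneg)] at hsec
      refine hsec.trans (measure_mono ?_)
      rintro _ ⟨y, hy, rfl⟩
      have hy' : dist (y : X) o' < R / 2 := hy
      refine ⟨?_, ?_⟩
      · rw [Metric.mem_ball]
        linarith [dist_triangle (y : X) o' o, dist_comm o o']
      · rw [mem_preimage, hKF _ y.2]; simp
    calc ENNReal.ofReal (b / 2 ^ n * R ^ (n + 1))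
        = ENNReal.ofReal (b * (R / 2) ^ n) * volume (Ioo (F o - R / 2) (F o + R / 2)) := by
          rw [Real.volume_Ioo, ← ENNReal.ofReal_mul (by positivity)]
          congr 1
          rw [div_pow]
          ring
      _ = ∫⁻ _ in Ioo (F o - R / 2) (F o + R / 2), ENNReal.ofReal (b * (R / 2) ^ n) := by
          rw [setLIntegral_const]
      _ ≤ ∫⁻ u in Ioo (F o - R / 2) (F o + R / 2), μH[(n : ℝ)] (Metric.ball o R ∩ F ⁻¹' {u}) :=
          setLIntegral_mono' measurableSet_Ioo hfiber
      _ ≤ ∫⁻ u, μH[(n : ℝ)] (Metric.ball o R ∩ F ⁻¹' {u}) := setLIntegral_le_lintegral _ _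
      _ ≤ _ := lintegral_hausdorffMeasure_fiber_le hF n _

theorem IsHilbertDist.isHilbertChart {n : ℕ} {Ω : Set (Euc n)} {d : Euc n → Euc n → ℝ}
    (hΩ : IsConvexDomain Ω) (hd : IsHilbertDist Ω d) {X : Type} [MetricSpace X] {φ : X → Euc n}
    (hφ : BijOn φ univ Ω) (hdist : ∀ p q : X, dist p q = d (φ p) (φ q)) : IsHilbertChart φ := by
  have hrange : range φ = Ω := by rw [← image_univ, hφ.image_eq]
  have hinj : Function.Injective φ := Set.injOn_univ.1 hφ.injOn
  refine ⟨hinj, hrange ▸ hΩ.2.1, hrange ▸ hΩ.2.2.1, hrange ▸ hΩ.2.2.2, ?_⟩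
  intro p q hpq s t hs ht ha hb
  rw [hrange] at ha hb
  have hne : φ p ≠ φ q := hinj.ne hpq
  have hn : ‖φ q - φ p‖ ≠ 0 := norm_ne_zero_iff.2 (sub_ne_zero.2 hne.symm)
  rw [hdist, hd.2 _ (hrange ▸ mem_range_self p) _ (hrange ▸ mem_range_self q) hne _ _ ha hb
    ⟨s, t, hs, ht, rfl, rfl⟩]
  have hp : ∀ r : ℝ, ‖φ p - (φ p + r • (φ q - φ p))‖ = |r| * ‖φ q - φ p‖ := fun r => by
    rw [sub_add_cancel_left, norm_neg, norm_smul, Real.norm_eq_abs]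
  have hq : ∀ r : ℝ, ‖φ q - (φ p + r • (φ q - φ p))‖ = |1 - r| * ‖φ q - φ p‖ := fun r => by
    rw [← Real.norm_eq_abs, ← norm_smul]
    congr 1
    module
  rw [hp, hp, hq, hq, mul_div_mul_right _ _ hn, mul_div_mul_right _ _ hn, abs_of_neg hs,
    abs_of_pos (by linarith : 0 < 1 - s), abs_of_pos (by linarith : 0 < t),
    abs_of_neg (by linarith : 1 - t < 0), neg_sub]

/-- **Uniform lower bound for metric balls (Vernicos).**  For each `n` there is a constant
`bₙ > 0` such that for every Hilbert geometry `(Ω, d_Ω)` of dimension `n` (realized as an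
abstract metric space `X` identified with `(Ω, d_Ω)` via `φ`), every point `o ∈ Ω` and every
`R ≥ 1`, the `n`-dimensional Hausdorff measure (with respect to `d_Ω`) of the metric ball of
radius `R` centered at `o` is at least `bₙ · Rⁿ`. -/
theorem hilbert_ball_volume_lower_bound (n : ℕ) :
    ∃ b : ℝ, 0 < b ∧
      ∀ (Ω : Set (Euc n)) (d : Euc n → Euc n → ℝ),
        IsConvexDomain Ω → IsHilbertDist Ω d →
        ∀ (X : Type) [MetricSpace X] [MeasurableSpace X] [BorelSpace X]
          (φ : X → Euc n), Set.BijOn φ Set.univ Ω →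
          (∀ p q : X, dist p q = d (φ p) (φ q)) →
          ∀ (o : X) (R : ℝ), 1 ≤ R →
            ENNReal.ofReal (b * R ^ n) ≤ μH[(n : ℝ)] (Metric.ball o R) := by
  obtain ⟨b, hb, h⟩ := IsHilbertChart.exists_le_hausdorffMeasure_ball n
  refine ⟨b, hb, ?_⟩
  intro Ω d hΩ hd X _ _ _ φ hφ hdist o R hR
  exact h (Euc n) (by simp) X φ (hd.isHilbertChart hΩ hφ hdist) o R (by linarith)
end
end
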